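/- arXiv:2304.08903 — 8 statements merged into one kernel-verified Lean document; each statement's English description precedes it below -/
import Mathlib

section
/- For every y > 0, one has lim_{n→∞} n · Leb({x ∈ [0,1] : ψ(x) > y · (24 + 16√2) n²}) = y^{−1/2}. (That is, the stationary process X_n = ψ ∘ fⁿ has a ½-regularly varying tail with normalizing sequence a_n = (24 + 16√2) n².) -/
open MeasureTheory Filter Set

/-- The tripling map `f(x) = 3x mod 1`. -/
noncomputable def fT : ℝ → ℝ := fun x => Int.fract (3 * x)

/-- `ζ = Σ_{j=1}^∞ 3^{−3^j}`. -/
noncomputable def zetaT : ℝ := ∑' j : ℕ, ((3 : ℝ) ^ (3 ^ (j + 1) : ℕ))⁻¹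

/-- The return times: `m₁ = 0` and `m_l = 3^{l−1}` for `l ≥ 2`. -/
def mT : ℕ → ℕ := fun l => if l = 1 then 0 else 3 ^ (l - 1)

/-- The maximal points `ξᵢ = f^{mᵢ}(ζ)` (so `ξ₁ = ζ`, `ξᵢ = f^{3^{i−1}}(ζ)` for `i ≥ 2`). -/
noncomputable def xiT : ℕ → ℝ := fun i => fT^[mT i] zetaT

/-- With the convention `0⁻² = 0`, the function `a² d⁻²` exceeds `(a / r)²` exactly for
nonzero `d` less than `r`. -/
theorem lt_sq_mul_zpow_neg_two_iff {a r d : ℝ} (ha : 0 < a) (hr : 0 < r) (hd : 0 ≤ d) :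
    (a / r) ^ 2 < a ^ 2 * d ^ (-2 : ℤ) ↔ d ≠ 0 ∧ d < r := by
  rcases hd.eq_or_lt with rfl | hd
  · simp only [ne_eq, not_true_eq_false, false_and, iff_false, not_lt]
    rw [zero_zpow _ (by norm_num), mul_zero]
    positivity
  · have h : a ^ 2 * d ^ (-2 : ℤ) = (a / d) ^ 2 := by
      rw [zpow_neg, div_pow, div_eq_mul_inv]
      norm_cast
    rw [h, pow_lt_pow_iff_left₀ (by positivity) (by positivity) two_ne_zero,
      div_lt_div_iff_of_pos_left ha hr hd]
    simp [hd.ne']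

/-- The total length of pairwise disjoint balls with their centers removed. -/
theorem volume_iUnion_ball_diff_center (c ρ : ℕ → ℝ) (hρ : ∀ i, 0 ≤ ρ i)
    (hd : Pairwise fun i j => Disjoint (Metric.ball (c i) (ρ i)) (Metric.ball (c j) (ρ j))) :
    (volume (⋃ i, Metric.ball (c i) (ρ i) \ {c i})).toReal = ∑' i, 2 * ρ i := by
  rw [measure_iUnion (fun i j hij => (hd hij).mono sdiff_subset sdiff_subset)
    (fun i => measurableSet_ball.diff (measurableSet_singleton _))]
  have h : ∀ i, volume (Metric.ball (c i) (ρ i) \ {c i}) = ENNReal.ofReal (2 * ρ i) := fun i => by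
    rw [measure_sdiff_null (measure_singleton _), Real.volume_ball]
  simp_rw [h]
  rw [ENNReal.tsum_toReal_eq fun _ => ENNReal.ofReal_ne_top]
  exact tsum_congr fun i => ENNReal.toReal_ofReal (by linarith [hρ i])

/-- Truncating the terms of a summable sequence at levels which grow linearly
does not change the limiting sum. -/
theorem tendsto_mul_tsum_min (e b : ℕ → ℝ) (he : ∀ i, 0 < e i) (hb : ∀ i, 0 ≤ b i)
    (hs : Summable b) :
    Tendsto (fun n : ℕ => (n : ℝ) * ∑' i, 2 * min (e i) (b i / n)) atTop
      (nhds (∑' i, 2 * b i)) := by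
  simp_rw [← tsum_mul_left]
  refine tendsto_tsum_of_dominated_convergence (bound := fun i => 2 * b i) (hs.mul_left 2) ?_ ?_
  · intro i
    refine tendsto_const_nhds.congr' ?_
    obtain ⟨N, hN⟩ := exists_nat_gt (b i / e i)
    filter_upwards [eventually_ge_atTop N, eventually_gt_atTop 0] with n hn hn0
    have hn0' : (0 : ℝ) < n := by exact_mod_cast hn0
    have h : b i / n ≤ e i := by
      rw [div_le_iff₀ hn0', ← div_le_iff₀' (he i)]
      exact hN.le.trans (by exact_mod_cast hn)
    rw [min_eq_right h]
    field_simp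
  · filter_upwards [eventually_gt_atTop 0] with n hn i
    have hn' : (0 : ℝ) < n := by exact_mod_cast hn
    have h0 : 0 ≤ min (e i) (b i / n) := le_min (he i).le (div_nonneg (hb i) hn'.le)
    rw [Real.norm_of_nonneg (by positivity)]
    calc (n : ℝ) * (2 * min (e i) (b i / n)) ≤ n * (2 * (b i / n)) := by
          gcongr
          exact min_le_right _ _
      _ = 2 * b i := by field_simp

/-- for every `y > 0`,
`lim_{n→∞} n · Leb({x ∈ [0,1] : ψ(x) > y · (24 + 16√2) n²}) = y^{−1/2}`. -/
theorem stmt2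
    (ε : ℕ → ℝ) (hε : ∀ i, 1 ≤ i → 0 < ε i)
    (hdisj : ∀ i j, 1 ≤ i → 1 ≤ j → i ≠ j →
      Disjoint (Metric.ball (xiT i) (ε i)) (Metric.ball (xiT j) (ε j)))
    (hsub : ∀ i, 1 ≤ i → Metric.ball (xiT i) (ε i) ⊆ Ioo (0:ℝ) 1)
    (ψ : ℝ → ℝ)
    (hψ : ∀ i, 1 ≤ i → ∀ x ∈ Metric.ball (xiT i) (ε i),
      ψ x = ((2 : ℝ) ^ (i - 1))⁻¹ * |x - xiT i| ^ (-2 : ℤ))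
    (hψ₀ : ∀ x, (∀ i, 1 ≤ i → x ∉ Metric.ball (xiT i) (ε i)) → ψ x = 0)
    (y : ℝ) (hy : 0 < y) :
    Tendsto
      (fun n : ℕ =>
        (n : ℝ) *
          (volume {x ∈ Icc (0:ℝ) 1 |
            ψ x > y * ((24 + 16 * Real.sqrt 2) * (n : ℝ) ^ 2)}).toReal)
      atTop (nhds (y ^ (-(1/2) : ℝ))) := by
  set c : ℝ := 4 + 2 * Real.sqrt 2 with hc
  set s : ℝ := (Real.sqrt 2)⁻¹ with hs
  have h2 : Real.sqrt 2 ^ 2 = 2 := Real.sq_sqrt zero_le_two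
  have hs0 : 0 < s := by positivity
  have hs1 : s < 1 := inv_lt_one_of_one_lt₀ (Real.lt_sqrt_of_sq_lt (by norm_num))
  have hc0 : 0 < c := by positivity
  have hcc : 24 + 16 * Real.sqrt 2 = c ^ 2 := by rw [hc]; linear_combination (-4) * h2
  have hy0 : 0 < Real.sqrt y := Real.sqrt_pos.mpr hy
  have hyy : Real.sqrt y ^ 2 = y := Real.sq_sqrt hy.le
  have hsi : ∀ i : ℕ, ((2 : ℝ) ^ i)⁻¹ = (s ^ i) ^ 2 := fun i => by
    rw [← pow_mul, mul_comm, pow_mul, hs, inv_pow, h2, inv_pow]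
  set b : ℕ → ℝ := fun i => s ^ i * (Real.sqrt y * c)⁻¹ with hb
  have hsum : ∑' i, 2 * b i = y ^ (-(1 / 2) : ℝ) := by
    rw [tsum_mul_left, hb, tsum_mul_right, tsum_geometric_of_lt_one hs0.le hs1,
      Real.rpow_neg hy.le, ← Real.sqrt_eq_rpow, mul_inv]
    have hcs : c * (1 - s) = 2 := by
      have hss : Real.sqrt 2 * s = 1 := mul_inv_cancel₀ (by positivity)
      have hs2 : s = Real.sqrt 2 / 2 := by
        linear_combination (Real.sqrt 2 / 2) * hss - (s / 2) * h2
      rw [hc, hs2]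
      linear_combination (-1) * h2
    have h1 : 1 - s ≠ 0 := by linarith
    field_simp
    linear_combination (-1) * hcs
  rw [← hsum]
  refine (tendsto_mul_tsum_min (fun i => ε (i + 1)) b (fun i => hε _ (by omega))
    (fun i => by positivity)
    ((summable_geometric_of_lt_one hs0.le hs1).mul_right _)).congr' ?_
  filter_upwards [eventually_gt_atTop 0] with n hn
  have hn' : (0 : ℝ) < n := by exact_mod_cast hn
  have hbn : ∀ i, 0 < b i / n := fun i => by positivity
  congr 1
  rw [← volume_iUnion_ball_diff_center (fun i => xiT (i + 1))
    (fun i => min (ε (i + 1)) (b i / n))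
    (fun i => le_min (hε _ (by omega)).le (hbn i).le)
    (fun i j hij => (hdisj (i + 1) (j + 1) (by omega) (by omega) (by omega)).mono
      (Metric.ball_subset_ball (min_le_left _ _)) (Metric.ball_subset_ball (min_le_left _ _)))]
  congr 2
  have ht : ∀ i, y * ((24 + 16 * Real.sqrt 2) * (n : ℝ) ^ 2) = (s ^ i / (b i / n)) ^ 2 :=
    fun i => by
      have : s ^ i / (b i / n) = Real.sqrt y * c * n := by
        simp only [hb]
        field_simp
      rw [this, hcc, mul_pow, mul_pow, hyy]
      ring
  have key : ∀ i, ∀ x ∈ Metric.ball (xiT (i + 1)) (ε (i + 1)),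
      (ψ x > y * ((24 + 16 * Real.sqrt 2) * (n : ℝ) ^ 2) ↔
        |x - xiT (i + 1)| ≠ 0 ∧ |x - xiT (i + 1)| < b i / n) := fun i x hx => by
    rw [hψ (i + 1) (by omega) x hx, Nat.add_sub_cancel, hsi, ht i, gt_iff_lt,
      lt_sq_mul_zpow_neg_two_iff (by positivity) (hbn i) (abs_nonneg _)]
  ext x
  simp only [mem_iUnion, Set.mem_sdiff, Metric.mem_ball, mem_singleton_iff, mem_ofPred_eq, lt_min_iff]
  constructor
  · rintro ⟨i, ⟨hx, hxb⟩, hne⟩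
    refine ⟨Ioo_subset_Icc_self (hsub (i + 1) (by omega) hx), (key i x hx).2 ⟨?_, ?_⟩⟩
    · simpa [sub_eq_zero] using hne
    · rwa [← Real.dist_eq]
  · rintro ⟨-, hx⟩
    by_cases h : ∀ i, 1 ≤ i → x ∉ Metric.ball (xiT i) (ε i)
    · rw [hψ₀ x h] at hx
      exact absurd hx (not_lt.mpr (by positivity))
    · push Not at h
      obtain ⟨i, hi, hxi⟩ := h
      obtain ⟨k, rfl⟩ := Nat.exists_eq_add_of_le' hi
      obtain ⟨hne, hlt⟩ := (key k x hxi).1 hx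
      refine ⟨k, ⟨hxi, by rwa [Real.dist_eq]⟩, ?_⟩
      simpa [sub_eq_zero] using hne
end

section
/- There exists u₀ > 0 such that for all u ≥ u₀: Leb({x ∈ [0,1] : ψ(x) > u}) = 6 u^{−1/2}, and Leb({x : ψ(x) > u} ∩ ⋂_{j=1}^{3} f^{−j}({x : ψ(x) ≤ u})) = (9/2) u^{−1/2}. -/
open MeasureTheory Filter Set

/-- The doubling map `f(x) = 2x mod 1`. -/
noncomputable def fD : ℝ → ℝ := fun x => Int.fract (2 * x)

/-- `ξ₁ = ζ = √2/16`. -/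
noncomputable def xi1 : ℝ := Real.sqrt 2 / 16
/-- `ξ₂ = f(ζ) = √2/8`. -/
noncomputable def xi2 : ℝ := Real.sqrt 2 / 8
/-- `ξ₃ = f³(ζ) = √2/2`. -/
noncomputable def xi3 : ℝ := Real.sqrt 2 / 2

/-- An annulus of the line, closed at the inner radius, has length `2 * (b - a)`. -/
lemma volume_real_ball_sdiff_ball {c a b : ℝ} (ha : 0 ≤ a) (hab : a ≤ b) :
    volume.real (Metric.ball c b \ Metric.ball c a) = 2 * (b - a) := by
  rw [measureReal_sdiff (Metric.ball_subset_ball hab) measurableSet_ball,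
    Real.volume_real_ball (ha.trans hab), Real.volume_real_ball ha]
  ring

lemma volume_real_ball_sdiff_singleton {c b : ℝ} (hb : 0 ≤ b) :
    volume.real (Metric.ball c b \ {c}) = 2 * b := by
  rw [measureReal_def, measure_sdiff_null (measure_singleton c), ← measureReal_def,
    Real.volume_real_ball hb]

/-- Volumes add up over measurable subsets of three pairwise disjoint balls. -/
lemma volume_real_union_of_subset_ball {c₁ c₂ c₃ r : ℝ} {A B C : Set ℝ}
    (hB : MeasurableSet B) (hC : MeasurableSet C)
    (hA' : A ⊆ Metric.ball c₁ r) (hB' : B ⊆ Metric.ball c₂ r) (hC' : C ⊆ Metric.ball c₃ r)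
    (h₁₂ : Disjoint (Metric.ball c₁ r) (Metric.ball c₂ r))
    (h₁₃ : Disjoint (Metric.ball c₁ r) (Metric.ball c₃ r))
    (h₂₃ : Disjoint (Metric.ball c₂ r) (Metric.ball c₃ r)) :
    volume.real (A ∪ B ∪ C) = volume.real A + volume.real B + volume.real C := by
  have fA : volume A ≠ ⊤ := ((measure_mono hA').trans_lt measure_ball_lt_top).ne
  have fB : volume B ≠ ⊤ := ((measure_mono hB').trans_lt measure_ball_lt_top).ne
  have fC : volume C ≠ ⊤ := ((measure_mono hC').trans_lt measure_ball_lt_top).ne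
  rw [measureReal_union ((h₁₃.mono hA' hC').union_left (h₂₃.mono hB' hC')) hC
      (measure_union_ne_top fA fB) fC, measureReal_union (h₁₂.mono hA' hB') hB fA fB]

/-- `|t|⁻² > r⁻²` exactly on the punctured ball, as `0⁻² = 0` in Lean. -/
lemma lt_abs_zpow_neg_two_iff {r t u : ℝ} (hr : 0 < r) (hu : u = (r ^ 2)⁻¹) :
    u < |t| ^ (-2 : ℤ) ↔ t ≠ 0 ∧ |t| < r := by
  have h2 : |t| ^ (-2 : ℤ) = (|t| ^ 2)⁻¹ := by
    rw [zpow_neg]; norm_cast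
  rw [h2, hu]
  by_cases ht : t = 0
  · simp [ht]
    positivity
  · have := abs_pos.mpr ht
    rw [inv_lt_inv₀ (by positivity) (by positivity), pow_lt_pow_iff_left₀ this.le hr.le two_ne_zero]
    simp [ht]

lemma fD_eq_sub {x : ℝ} (n : ℤ) (h₀ : n ≤ 2 * x) (h₁ : 2 * x < n + 1) : fD x = 2 * x - n := by
  rw [fD, Int.fract, Int.floor_eq_iff.mpr ⟨h₀, h₁⟩]

/-- for all large `u`,
`Leb({ψ > u}) = 6u^{−1/2}` and
`Leb({ψ > u} ∩ ⋂_{j=1}^{3} f^{−j}({ψ ≤ u})) = (9/2)u^{−1/2}`. -/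
theorem stmt4
    (ε₁ ε₂ ε₃ : ℝ) (hε₁ : 0 < ε₁) (hε₂ : 0 < ε₂) (hε₃ : 0 < ε₃)
    (hd₁₂ : Disjoint (Metric.ball xi1 ε₁) (Metric.ball xi2 ε₂))
    (hd₁₃ : Disjoint (Metric.ball xi1 ε₁) (Metric.ball xi3 ε₃))
    (hd₂₃ : Disjoint (Metric.ball xi2 ε₂) (Metric.ball xi3 ε₃))
    (hsub : Metric.ball xi1 ε₁ ∪ Metric.ball xi2 ε₂ ∪ Metric.ball xi3 ε₃ ⊆ Ioo (0:ℝ) 1)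
    (ψ : ℝ → ℝ)
    (hψ₁ : ∀ x ∈ Metric.ball xi1 ε₁, ψ x = |x - xi1| ^ (-2 : ℤ))
    (hψ₂ : ∀ x ∈ Metric.ball xi2 ε₂, ψ x = |x - xi2| ^ (-2 : ℤ))
    (hψ₃ : ∀ x ∈ Metric.ball xi3 ε₃, ψ x = |x - xi3| ^ (-2 : ℤ))
    (hψ₀ : ∀ x, x ∉ Metric.ball xi1 ε₁ ∪ Metric.ball xi2 ε₂ ∪ Metric.ball xi3 ε₃ → ψ x = 0) :
    ∃ u₀ : ℝ, 0 < u₀ ∧ ∀ u : ℝ, u₀ ≤ u →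
      (volume {x ∈ Icc (0:ℝ) 1 | ψ x > u}).toReal = 6 * u ^ (-(1/2) : ℝ) ∧
      (volume ({x ∈ Icc (0:ℝ) 1 | ψ x > u} ∩
          ⋂ j ∈ Finset.Icc 1 3, fD^[j] ⁻¹' {x : ℝ | ψ x ≤ u})).toReal =
        (9/2) * u ^ (-(1/2) : ℝ) := by
  set δ : ℝ := min (min ε₁ ε₂) (min ε₃ (1 / 1000)) with hδ
  have hδ0 : 0 < δ := by positivity
  refine ⟨(δ ^ 2)⁻¹, by positivity, fun u hu => ?_⟩
  have hu0 : 0 < u := lt_of_lt_of_le (by positivity) hu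
  set r : ℝ := u ^ (-(1/2) : ℝ) with hr
  have hr0 : 0 < r := Real.rpow_pos_of_pos hu0 _
  have hr2 : r ^ 2 = u⁻¹ := by
    rw [hr, ← Real.rpow_natCast, ← Real.rpow_mul hu0.le, ← Real.rpow_neg_one]
    norm_num
  have hur : u = (r ^ 2)⁻¹ := by rw [hr2, inv_inv]
  have hrδ : r ≤ δ := by
    rw [← pow_le_pow_iff_left₀ hr0.le hδ0.le two_ne_zero, hr2]
    exact inv_le_of_inv_le₀ (by positivity) hu
  have hr₁ : r ≤ ε₁ := hrδ.trans ((min_le_left _ _).trans (min_le_left _ _))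
  have hr₂ : r ≤ ε₂ := hrδ.trans ((min_le_left _ _).trans (min_le_right _ _))
  have hr₃ : r ≤ ε₃ := hrδ.trans ((min_le_right _ _).trans (min_le_left _ _))
  have hrs : r ≤ 1 / 1000 := hrδ.trans ((min_le_right _ _).trans (min_le_right _ _))
  clear_value r δ
  have hb₁ := Metric.ball_subset_ball (x := xi1) hr₁
  have hb₂ := Metric.ball_subset_ball (x := xi2) hr₂
  have hb₃ := Metric.ball_subset_ball (x := xi3) hr₃
  have h₁₂ := hd₁₂.mono hb₁ hb₂
  have h₁₃ := hd₁₃.mono hb₁ hb₃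
  have h₂₃ := hd₂₃.mono hb₂ hb₃
  have key : ∀ x, u < ψ x ↔
      (x - xi1 ≠ 0 ∧ |x - xi1| < r) ∨ (x - xi2 ≠ 0 ∧ |x - xi2| < r) ∨
        (x - xi3 ≠ 0 ∧ |x - xi3| < r) := by
    intro x
    constructor
    · intro h
      by_cases hx : x ∈ Metric.ball xi1 ε₁ ∪ Metric.ball xi2 ε₂ ∪ Metric.ball xi3 ε₃
      · rcases hx with (hx | hx) | hx
        · rw [hψ₁ x hx, lt_abs_zpow_neg_two_iff hr0 hur] at h
          exact Or.inl h
        · rw [hψ₂ x hx, lt_abs_zpow_neg_two_iff hr0 hur] at h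
          exact Or.inr (Or.inl h)
        · rw [hψ₃ x hx, lt_abs_zpow_neg_two_iff hr0 hur] at h
          exact Or.inr (Or.inr h)
      · rw [hψ₀ x hx] at h
        exact absurd h hu0.not_gt
    · rintro (h | h | h)
      · rwa [hψ₁ x (hb₁ h.2), lt_abs_zpow_neg_two_iff hr0 hur]
      · rwa [hψ₂ x (hb₂ h.2), lt_abs_zpow_neg_two_iff hr0 hur]
      · rwa [hψ₃ x (hb₃ h.2), lt_abs_zpow_neg_two_iff hr0 hur]
  have hE : {x ∈ Icc (0:ℝ) 1 | ψ x > u} =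
      Metric.ball xi1 r \ {xi1} ∪ Metric.ball xi2 r \ {xi2} ∪ Metric.ball xi3 r \ {xi3} := by
    ext x
    have hI : x ∈ Metric.ball xi1 r ∪ Metric.ball xi2 r ∪ Metric.ball xi3 r → x ∈ Icc (0:ℝ) 1 :=
      fun h => Ioo_subset_Icc_self (hsub (union_subset_union (union_subset_union hb₁ hb₂) hb₃ h))
    have hP : ∀ c, x ∈ Metric.ball c r \ {c} ↔ x - c ≠ 0 ∧ |x - c| < r := fun c => by
      rw [Set.mem_sdiff, mem_singleton_iff, Metric.mem_ball, Real.dist_eq, sub_ne_zero, and_comm]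
    rw [mem_ofPred_eq, gt_iff_lt, key, ← hP, ← hP, ← hP, ← mem_union, ← mem_union, ← union_assoc]
    exact and_iff_right_of_imp fun h => hI (union_subset_union (union_subset_union sdiff_subset
      sdiff_subset) sdiff_subset h)
  have hs0 : (1.4142 : ℝ) < Real.sqrt 2 := Real.lt_sqrt_of_sq_lt (by norm_num)
  have hs1 : Real.sqrt 2 < 1.4143 := (Real.sqrt_lt' (by norm_num)).mpr (by norm_num)
  have hF : {x ∈ Icc (0:ℝ) 1 | ψ x > u} ∩ ⋂ j ∈ Finset.Icc 1 3, fD^[j] ⁻¹' {x : ℝ | ψ x ≤ u} =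
      Metric.ball xi1 r \ Metric.ball xi1 (r / 2) ∪ Metric.ball xi2 r \ Metric.ball xi2 (r / 4) ∪
        Metric.ball xi3 r \ {xi3} := by
    have hJ : (⋂ j ∈ Finset.Icc 1 3, fD^[j] ⁻¹' {x : ℝ | ψ x ≤ u}) =
        {x | ¬ u < ψ (fD x) ∧ ¬ u < ψ (fD (fD x)) ∧ ¬ u < ψ (fD (fD (fD x)))} := by
      ext x
      have : Finset.Icc 1 3 = ({1, 2, 3} : Finset ℕ) := rfl
      simp [this]
    have near : ∀ {x : ℝ}, (x ∈ Metric.ball xi1 r → (x ∈ {x | ¬ u < ψ (fD x) ∧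
          ¬ u < ψ (fD (fD x)) ∧ ¬ u < ψ (fD (fD (fD x)))} ↔
            x = xi1 ∨ r / 2 ≤ |x - xi1|)) ∧
        (x ∈ Metric.ball xi2 r → (x ∈ {x | ¬ u < ψ (fD x) ∧
          ¬ u < ψ (fD (fD x)) ∧ ¬ u < ψ (fD (fD (fD x)))} ↔
            x = xi2 ∨ r / 4 ≤ |x - xi2|)) ∧
        (x ∈ Metric.ball xi3 r → x ∈ {x | ¬ u < ψ (fD x) ∧
          ¬ u < ψ (fD (fD x)) ∧ ¬ u < ψ (fD (fD (fD x)))}) := by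
      intro x
      simp only [Metric.mem_ball, Real.dist_eq, mem_ofPred_eq, key, xi1, xi2, xi3]
      refine ⟨fun hx => ?_, fun hx => ?_, fun hx => ?_⟩
      · have hx' := abs_lt.mp hx
        have e1 : fD x = 2 * x := by
          rw [fD_eq_sub 0 (by push_cast; linarith) (by push_cast; linarith)]; simp
        have e2 : fD (2 * x) = 4 * x := by
          rw [fD_eq_sub 0 (by push_cast; linarith) (by push_cast; linarith)]; push_cast; ring
        have e3 : fD (4 * x) = 8 * x := by
          rw [fD_eq_sub 0 (by push_cast; linarith) (by push_cast; linarith)]; push_cast; ring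
        rw [e1, e2, e3]
        constructor
        · rintro ⟨h, -, -⟩
          by_contra! hc
          refine h (Or.inr (Or.inl ⟨fun h0 => hc.1 (by linarith), ?_⟩))
          have := abs_lt.mp hc.2
          rw [abs_lt]
          constructor <;> linarith
        · rintro (h | h)
          · subst h
            simp only [abs_lt]
            refine ⟨?_, ?_, ?_⟩ <;> rintro (h | h | h) <;>
              first | linarith [h.2.1, h.2.2] | exact h.1 (by ring)
          · rw [le_abs] at h
            simp only [abs_lt]
            refine ⟨?_, ?_, ?_⟩ <;> rintro (h' | h' | h') <;> rcases h with h | h <;>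
              linarith [h'.2.1, h'.2.2]
      · have hx' := abs_lt.mp hx
        have e1 : fD x = 2 * x := by
          rw [fD_eq_sub 0 (by push_cast; linarith) (by push_cast; linarith)]; simp
        have e2 : fD (2 * x) = 4 * x := by
          rw [fD_eq_sub 0 (by push_cast; linarith) (by push_cast; linarith)]; push_cast; ring
        have e3 : fD (4 * x) = 8 * x - 1 := by
          rw [fD_eq_sub 1 (by push_cast; linarith) (by push_cast; linarith)]; push_cast; ring
        rw [e1, e2, e3]
        constructor
        · rintro ⟨-, h, -⟩
          by_contra! hc
          refine h (Or.inr (Or.inr ⟨fun h0 => hc.1 (by linarith), ?_⟩))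
          have := abs_lt.mp hc.2
          rw [abs_lt]
          constructor <;> linarith
        · rintro (h | h)
          · subst h
            simp only [abs_lt]
            refine ⟨?_, ?_, ?_⟩ <;> rintro (h | h | h) <;>
              first | linarith [h.2.1, h.2.2] | exact h.1 (by ring)
          · rw [le_abs] at h
            simp only [abs_lt]
            refine ⟨?_, ?_, ?_⟩ <;> rintro (h' | h' | h') <;> rcases h with h | h <;>
              linarith [h'.2.1, h'.2.2]
      · have hx' := abs_lt.mp hx
        have e1 : fD x = 2 * x - 1 := by
          rw [fD_eq_sub 1 (by push_cast; linarith) (by push_cast; linarith)]; simp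
        have e2 : fD (2 * x - 1) = 4 * x - 2 := by
          rw [fD_eq_sub 0 (by push_cast; linarith) (by push_cast; linarith)]; push_cast; ring
        have e3 : fD (4 * x - 2) = 8 * x - 5 := by
          rw [fD_eq_sub 1 (by push_cast; linarith) (by push_cast; linarith)]; push_cast; ring
        rw [e1, e2, e3]
        simp only [abs_lt]
        refine ⟨?_, ?_, ?_⟩ <;> rintro (h | h | h) <;> linarith [h.2.1, h.2.2]
    rw [hE, hJ]
    ext x
    obtain ⟨n₁, n₂, n₃⟩ := near (x := x)
    rw [mem_inter_iff]
    simp only [mem_union, or_and_right]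
    refine or_congr (or_congr ?_ ?_) ?_
    · rw [Set.mem_sdiff, Set.mem_sdiff, and_assoc]
      refine and_congr_right fun hx => ?_
      rw [n₁ hx, mem_singleton_iff, Metric.mem_ball, Real.dist_eq, not_lt]
      refine ⟨fun h => h.2.resolve_left h.1, fun h => ⟨?_, Or.inr h⟩⟩
      rintro rfl
      rw [sub_self, abs_zero] at h
      linarith
    · rw [Set.mem_sdiff, Set.mem_sdiff, and_assoc]
      refine and_congr_right fun hx => ?_
      rw [n₂ hx, mem_singleton_iff, Metric.mem_ball, Real.dist_eq, not_lt]
      refine ⟨fun h => h.2.resolve_left h.1, fun h => ⟨?_, Or.inr h⟩⟩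
      rintro rfl
      rw [sub_self, abs_zero] at h
      linarith
    · exact and_iff_left_of_imp fun hx => n₃ hx.1
  have hS : ∀ c : ℝ, MeasurableSet (Metric.ball c r \ {c}) :=
    fun c => measurableSet_ball.diff (measurableSet_singleton c)
  rw [hF, hE, ← measureReal_def, ← measureReal_def,
    volume_real_union_of_subset_ball (hS _) (hS _)
      sdiff_subset sdiff_subset sdiff_subset h₁₂ h₁₃ h₂₃,
    volume_real_union_of_subset_ball (measurableSet_ball.diff measurableSet_ball) (hS _)
      sdiff_subset sdiff_subset sdiff_subset h₁₂ h₁₃ h₂₃,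
    volume_real_ball_sdiff_ball (by positivity) (by linarith),
    volume_real_ball_sdiff_ball (by positivity) (by linarith)]
  simp only [volume_real_ball_sdiff_singleton hr0.le]
  constructor <;> ring
end

section
/- Let B₁(u) be the Euclidean ball of radius u^{−1/4} centred at ζ and B₂(u) the Euclidean ball of radius 4u^{−1/4} centred at f(ζ). There exists u₀ > 0 such that for all u ≥ u₀: f(B₁(u)) ⊆ B₂(u), B₂(u) ∩ f^{−1}(B₁(u) ∪ B₂(u)) = ∅, and consequently (B₁(u) ∪ B₂(u)) \ f^{−1}(B₁(u) ∪ B₂(u)) = B₂(u). -/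
open MeasureTheory Filter Set
open scoped ENNReal

/-- The map `f(x,y) = (2x mod 1, 3y mod 1)` on the plane. -/
noncomputable def f2 : EuclideanSpace ℝ (Fin 2) → EuclideanSpace ℝ (Fin 2) :=
  fun p => (WithLp.equiv 2 (Fin 2 → ℝ)).symm ![Int.fract (2 * p 0), Int.fract (3 * p 1)]

/-- `ζ = (1/√2, 1/√2)`. -/
noncomputable def zeta2 : EuclideanSpace ℝ (Fin 2) :=
  (WithLp.equiv 2 (Fin 2 → ℝ)).symm ![1 / Real.sqrt 2, 1 / Real.sqrt 2]

theorem f2_apply_zero (p : EuclideanSpace ℝ (Fin 2)) : f2 p 0 = Int.fract (2 * p 0) := by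
  simp [f2]

theorem f2_apply_one (p : EuclideanSpace ℝ (Fin 2)) : f2 p 1 = Int.fract (3 * p 1) := by
  simp [f2]

theorem mem_ball_iff_sq_add_sq_lt {p q : EuclideanSpace ℝ (Fin 2)} {r : ℝ} (hr : 0 < r) :
    p ∈ Metric.ball q r ↔ (p 0 - q 0) ^ 2 + (p 1 - q 1) ^ 2 < r ^ 2 := by
  rw [Metric.mem_ball, EuclideanSpace.dist_eq, Real.sqrt_lt' hr, Fin.sum_univ_two,
    Real.dist_eq, Real.dist_eq, sq_abs, sq_abs]

theorem abs_apply_sub_lt_of_mem_ball {p q : EuclideanSpace ℝ (Fin 2)} {r : ℝ}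
    (h : p ∈ Metric.ball q r) (i : Fin 2) : |p i - q i| < r := by
  refine lt_of_le_of_lt ?_ (mem_ball_iff_norm.mp h)
  simpa using PiLp.norm_apply_le (p - q) i

theorem zeta2_apply (i : Fin 2) : zeta2 i = 1 / Real.sqrt 2 := by
  fin_cases i <;> simp [zeta2]

theorem one_div_sqrt_two_mem_Ioo : 1 / Real.sqrt 2 ∈ Ioo (0.707 : ℝ) 0.708 := by
  have hpos : 0 < 1 / Real.sqrt 2 := by positivity
  have hsq : (1 / Real.sqrt 2) ^ 2 = 1 / 2 := by
    rw [div_pow, Real.sq_sqrt zero_le_two, one_pow]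
  constructor <;> nlinarith

theorem fract_two_mul {x : ℝ} (h₁ : 1 / 2 ≤ x) (h₂ : x < 1) : Int.fract (2 * x) = 2 * x - 1 := by
  rw [Int.fract_eq_iff]
  exact ⟨by linarith, by linarith, 1, by push_cast; ring⟩

theorem fract_three_mul {x : ℝ} (h₁ : 2 / 3 ≤ x) (h₂ : x < 1) :
    Int.fract (3 * x) = 3 * x - 2 := by
  rw [Int.fract_eq_iff]
  exact ⟨by linarith, by linarith, 2, by push_cast; ring⟩

theorem f2_zeta2_apply_zero : f2 zeta2 0 = 2 * (1 / Real.sqrt 2) - 1 := by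
  obtain ⟨h₁, h₂⟩ := one_div_sqrt_two_mem_Ioo
  rw [f2_apply_zero, zeta2_apply, fract_two_mul (by linarith) (by linarith)]

theorem f2_zeta2_apply_one : f2 zeta2 1 = 3 * (1 / Real.sqrt 2) - 2 := by
  obtain ⟨h₁, h₂⟩ := one_div_sqrt_two_mem_Ioo
  rw [f2_apply_one, zeta2_apply, fract_three_mul (by linarith) (by linarith)]

theorem f2_image_ball_zeta2_subset {r : ℝ} (hr : 0 < r) (hr' : r ≤ 1 / 1000) :
    f2 '' Metric.ball zeta2 r ⊆ Metric.ball (f2 zeta2) (4 * r) := by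
  rintro _ ⟨p, hp, rfl⟩
  obtain ⟨hs₁, hs₂⟩ := one_div_sqrt_two_mem_Ioo
  have h0 := abs_lt.mp (abs_apply_sub_lt_of_mem_ball hp 0)
  have h1 := abs_lt.mp (abs_apply_sub_lt_of_mem_ball hp 1)
  rw [mem_ball_iff_sq_add_sq_lt hr] at hp
  rw [mem_ball_iff_sq_add_sq_lt (by positivity), f2_zeta2_apply_zero, f2_zeta2_apply_one,
    f2_apply_zero, f2_apply_one]
  rw [zeta2_apply] at h0 h1
  rw [zeta2_apply, zeta2_apply] at hp
  rw [fract_two_mul (by linarith) (by linarith), fract_three_mul (by linarith) (by linarith)]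
  nlinarith [sq_nonneg (p 0 - 1 / Real.sqrt 2)]

theorem ball_f2_zeta2_inter_preimage_eq_empty {r : ℝ} (hr : r ≤ 1 / 1000) :
    Metric.ball (f2 zeta2) (4 * r) ∩
      f2 ⁻¹' (Metric.ball zeta2 r ∪ Metric.ball (f2 zeta2) (4 * r)) = ∅ := by
  refine eq_empty_of_forall_notMem ?_
  rintro p ⟨hp, hfp⟩
  obtain ⟨hs₁, hs₂⟩ := one_div_sqrt_two_mem_Ioo
  have h0 := abs_lt.mp (abs_apply_sub_lt_of_mem_ball hp 0)
  rw [f2_zeta2_apply_zero] at h0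
  have hfract : f2 p 0 = 2 * p 0 := by
    rw [f2_apply_zero, Int.fract_eq_self]
    constructor <;> linarith
  rcases hfp with h | h
  · have h' := abs_lt.mp (abs_apply_sub_lt_of_mem_ball h 0)
    rw [hfract, zeta2_apply] at h'
    linarith
  · have h' := abs_lt.mp (abs_apply_sub_lt_of_mem_ball h 0)
    rw [hfract, f2_zeta2_apply_zero] at h'
    linarith

theorem union_diff_preimage_eq_right {α : Type*} {g : α → α} {s t : Set α}
    (hst : g '' s ⊆ t) (ht : t ∩ g ⁻¹' (s ∪ t) = ∅) : (s ∪ t) \ g ⁻¹' (s ∪ t) = t := by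
  rw [union_sdiff_distrib, (disjoint_iff_inter_eq_empty.mpr ht).sdiff_eq_left,
    sdiff_eq_empty.mpr ((image_subset_iff.mp hst).trans (preimage_mono subset_union_right)),
    empty_union]

theorem rpow_neg_quarter_le {u : ℝ} (hu : 10 ^ 12 ≤ u) : u ^ (-(1/4) : ℝ) ≤ 1 / 1000 := by
  calc u ^ (-(1/4) : ℝ) ≤ ((10 : ℝ) ^ 12) ^ (-(1/4) : ℝ) :=
        Real.rpow_le_rpow_of_nonpos (by positivity) hu (by norm_num)
    _ = 1 / 1000 := by
        rw [← Real.rpow_natCast, ← Real.rpow_mul (by norm_num),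
          show ((12 : ℕ) : ℝ) * (-(1/4)) = -((3 : ℕ) : ℝ) by norm_num,
          Real.rpow_neg (by norm_num), Real.rpow_natCast]
        norm_num

/-- with `B₁(u)` the ball of radius `u^{−1/4}` at `ζ` and `B₂(u)` the ball of
radius `4u^{−1/4}` at `f(ζ)`, for all large `u`: `f(B₁(u)) ⊆ B₂(u)`,
`B₂(u) ∩ f^{−1}(B₁(u) ∪ B₂(u)) = ∅`, and `(B₁(u) ∪ B₂(u)) \ f^{−1}(B₁(u) ∪ B₂(u)) = B₂(u)`. -/
theorem stmt6 :
    ∃ u₀ : ℝ, 0 < u₀ ∧ ∀ u : ℝ, u₀ ≤ u →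
      f2 '' Metric.ball zeta2 (u ^ (-(1/4) : ℝ)) ⊆
        Metric.ball (f2 zeta2) (4 * u ^ (-(1/4) : ℝ)) ∧
      Metric.ball (f2 zeta2) (4 * u ^ (-(1/4) : ℝ)) ∩
        f2 ⁻¹' (Metric.ball zeta2 (u ^ (-(1/4) : ℝ)) ∪
          Metric.ball (f2 zeta2) (4 * u ^ (-(1/4) : ℝ))) = ∅ ∧
      (Metric.ball zeta2 (u ^ (-(1/4) : ℝ)) ∪
          Metric.ball (f2 zeta2) (4 * u ^ (-(1/4) : ℝ))) \
        f2 ⁻¹' (Metric.ball zeta2 (u ^ (-(1/4) : ℝ)) ∪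
          Metric.ball (f2 zeta2) (4 * u ^ (-(1/4) : ℝ))) =
        Metric.ball (f2 zeta2) (4 * u ^ (-(1/4) : ℝ)) := by
  refine ⟨10 ^ 12, by positivity, fun u hu => ?_⟩
  have hpos : 0 < u ^ (-(1/4) : ℝ) := Real.rpow_pos_of_pos (by linarith) _
  have hle := rpow_neg_quarter_le hu
  have himage := f2_image_ball_zeta2_subset hpos hle
  have hempty := ball_f2_zeta2_inter_preimage_eq_empty hle
  exact ⟨himage, hempty, union_diff_preimage_eq_right himage hempty⟩
end

section
/- For each i ∈ ℕ, lim_{u→∞} Leb({x ∈ B_{εᵢ}(ξᵢ) : ψ(x) > u}) / Leb({x ∈ [0,1] : ψ(x) > u}) = (1 − 1/√2)(1/√2)^{i−1}. (Asymptotically, an exceedance of the level u by ψ is due to a hit to the ball around ξᵢ with probability pᵢ = (1 − 1/√2)(1/√2)^{i−1}.) -/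
open MeasureTheory Filter Set

/-- The points of a ball at which `c * |x - a| ^ (-2)` exceeds a positive level form a smaller
punctured ball. -/
lemma setOf_lt_inv_sq_eq {a r c u : ℝ} (hc : 0 < c) (hu : 0 < u) :
    {x ∈ Metric.ball a r | c * |x - a| ^ (-2 : ℤ) > u} =
      Metric.ball a (min r (√c / √u)) \ {a} := by
  ext x
  simp only [mem_ofPred_eq, Metric.mem_ball, Set.mem_sdiff, mem_singleton_iff, Real.dist_eq,
    lt_min_iff, gt_iff_lt, and_assoc]
  refine and_congr_right fun _ => ?_
  rcases eq_or_ne x a with rfl | hx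
  · simp [hu.le]
  · have hd : 0 < |x - a| := abs_pos.2 (sub_ne_zero.2 hx)
    simp only [hx, not_false_eq_true, and_true]
    rw [← Real.sqrt_div hc.le, Real.lt_sqrt hd.le, zpow_neg, ← div_eq_mul_inv,
      lt_div_iff₀ (by positivity), lt_div_iff₀ hu, mul_comm]
    norm_cast

lemma measurableSet_setOf_lt_inv_sq {a r c u : ℝ} (hc : 0 < c) (hu : 0 < u) :
    MeasurableSet {x ∈ Metric.ball a r | c * |x - a| ^ (-2 : ℤ) > u} := by
  rw [setOf_lt_inv_sq_eq hc hu]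
  exact measurableSet_ball.diff (measurableSet_singleton a)

lemma volume_setOf_lt_inv_sq {a r c u : ℝ} (hc : 0 < c) (hu : 0 < u) :
    volume {x ∈ Metric.ball a r | c * |x - a| ^ (-2 : ℤ) > u} =
      ENNReal.ofReal (2 * min r (√c / √u)) := by
  rw [setOf_lt_inv_sq_eq hc hu, measure_sdiff_null (measure_singleton a), Real.volume_ball]

lemma sqrt_mul_min_div_sqrt {r b u : ℝ} (hu : 0 < u) :
    √u * (2 * min r (b / √u)) = 2 * min (r * √u) b := by
  have h : 0 < √u := Real.sqrt_pos.2 hu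
  rw [mul_left_comm, mul_min_of_nonneg _ _ h.le, mul_div_cancel₀ _ h.ne', mul_comm r]

lemma tendsto_min_mul_sqrt {r : ℝ} (hr : 0 < r) (b : ℝ) :
    Tendsto (fun u : ℝ => 2 * min (r * √u) b) atTop (nhds (2 * b)) := by
  refine tendsto_const_nhds.congr' ?_
  filter_upwards [(Real.tendsto_sqrt_atTop.const_mul_atTop hr).eventually_ge_atTop b] with u hu
  rw [min_eq_right hu]

lemma tendsto_tsum_min_mul_sqrt {r b : ℕ → ℝ} (hr : ∀ k, 0 < r k) (hb : ∀ k, 0 ≤ b k)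
    (hs : Summable b) :
    Tendsto (fun u : ℝ => ∑' k, 2 * min (r k * √u) (b k)) atTop (nhds (∑' k, 2 * b k)) := by
  refine tendsto_tsum_of_dominated_convergence (bound := fun k => 2 * b k) (hs.mul_left 2)
    (fun k => tendsto_min_mul_sqrt (hr k) (b k)) (Eventually.of_forall fun u k => ?_)
  have h : 0 ≤ min (r k * √u) (b k) :=
    le_min (mul_nonneg (hr k).le (Real.sqrt_nonneg u)) (hb k)
  rw [Real.norm_of_nonneg (by positivity)]
  gcongr
  exact min_le_right _ _

lemma sqrt_inv_two_pow (k : ℕ) : √((2 : ℝ) ^ k)⁻¹ = (1 / √2) ^ k := by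
  rw [Real.sqrt_eq_iff_mul_self_eq (by positivity) (by positivity), ← mul_pow, ← inv_pow]
  congr 1
  rw [div_mul_div_comm, Real.mul_self_sqrt (by norm_num)]
  norm_num

/-- for each `i ∈ ℕ`,
`lim_{u→∞} Leb({x ∈ B_{εᵢ}(ξᵢ) : ψ(x) > u}) / Leb({x ∈ [0,1] : ψ(x) > u})
  = (1 − 1/√2)(1/√2)^{i−1}`. -/
theorem stmt9
    (ε : ℕ → ℝ) (hε : ∀ i, 1 ≤ i → 0 < ε i)
    (hdisj : ∀ i j, 1 ≤ i → 1 ≤ j → i ≠ j →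
      Disjoint (Metric.ball (xiT i) (ε i)) (Metric.ball (xiT j) (ε j)))
    (hsub : ∀ i, 1 ≤ i → Metric.ball (xiT i) (ε i) ⊆ Ioo (0:ℝ) 1)
    (ψ : ℝ → ℝ)
    (hψ : ∀ i, 1 ≤ i → ∀ x ∈ Metric.ball (xiT i) (ε i),
      ψ x = ((2 : ℝ) ^ (i - 1))⁻¹ * |x - xiT i| ^ (-2 : ℤ))
    (hψ₀ : ∀ x, (∀ i, 1 ≤ i → x ∉ Metric.ball (xiT i) (ε i)) → ψ x = 0)
    (i : ℕ) (hi : 1 ≤ i) :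
    Tendsto
      (fun u : ℝ =>
        (volume {x ∈ Metric.ball (xiT i) (ε i) | ψ x > u}).toReal /
          (volume {x ∈ Icc (0:ℝ) 1 | ψ x > u}).toReal)
      atTop
      (nhds ((1 - 1 / Real.sqrt 2) * (1 / Real.sqrt 2) ^ (i - 1))) := by
  obtain ⟨k, rfl⟩ : ∃ k, i = k + 1 := ⟨i - 1, by omega⟩
  set a : ℝ := 1 / √2 with ha
  have h2 : 1 < √2 := Real.lt_sqrt_of_sq_lt (by norm_num)
  have ha0 : 0 < a := by positivity
  have ha1 : a < 1 := by rw [ha, div_lt_one (by positivity)]; exact h2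
  let S : ℕ → ℝ → Set ℝ := fun j u => {x ∈ Metric.ball (xiT (j + 1)) (ε (j + 1)) | ψ x > u}
  have hS : ∀ j u, S j u = {x ∈ Metric.ball (xiT (j + 1)) (ε (j + 1)) |
      ((2 : ℝ) ^ j)⁻¹ * |x - xiT (j + 1)| ^ (-2 : ℤ) > u} := by
    intro j u
    ext x
    refine and_congr_right fun hx => ?_
    rw [hψ (j + 1) (by omega) x hx, Nat.add_sub_cancel]
  have hpos : ∀ j : ℕ, (0 : ℝ) < ((2 : ℝ) ^ j)⁻¹ := fun j => by positivity
  have hvol : ∀ j u, 0 < u → √u * (volume (S j u)).toReal = 2 * min (ε (j + 1) * √u) (a ^ j) := by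
    intro j u hu
    have : 0 ≤ min (ε (j + 1)) (√((2 : ℝ) ^ j)⁻¹ / √u) :=
      le_min (hε _ (by omega)).le (by positivity)
    rw [hS, volume_setOf_lt_inv_sq (hpos j) hu, ENNReal.toReal_ofReal (by positivity),
      sqrt_mul_min_div_sqrt hu, sqrt_inv_two_pow]
  have htotal : ∀ u, 0 < u → √u * (volume {x ∈ Icc (0:ℝ) 1 | ψ x > u}).toReal =
      ∑' j, 2 * min (ε (j + 1) * √u) (a ^ j) := by
    intro u hu
    have hU : {x ∈ Icc (0:ℝ) 1 | ψ x > u} = ⋃ j, S j u := by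
      ext x
      simp only [mem_iUnion]
      constructor
      · rintro ⟨-, hx⟩
        by_contra! hn
        refine absurd (hψ₀ x fun i hi hxi => ?_) (hu.trans hx).ne'
        obtain ⟨j, rfl⟩ : ∃ j, i = j + 1 := ⟨i - 1, by omega⟩
        exact hn j ⟨hxi, hx⟩
      · rintro ⟨j, hxj, hx⟩
        exact ⟨Ioo_subset_Icc_self (hsub (j + 1) (by omega) hxj), hx⟩
    have hd : Pairwise (Function.onFun Disjoint fun j => S j u) := fun j l hjl =>
      (hdisj (j + 1) (l + 1) (by omega) (by omega) (by omega)).mono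
        (sep_subset _ _) (sep_subset _ _)
    have hm : ∀ j, MeasurableSet (S j u) := fun j => by
      rw [hS]; exact measurableSet_setOf_lt_inv_sq (hpos j) hu
    rw [hU, measure_iUnion hd hm, ENNReal.tsum_toReal_eq fun j => ?_, ← tsum_mul_left]
    · exact tsum_congr fun j => hvol j u hu
    · exact ((measure_mono (sep_subset _ _)).trans_lt measure_ball_lt_top).ne
  have hlim : Tendsto (fun u : ℝ => (2 * min (ε (k + 1) * √u) (a ^ k)) /
      ∑' j, 2 * min (ε (j + 1) * √u) (a ^ j)) atTop (nhds ((2 * a ^ k) / ∑' j, 2 * a ^ j)) := by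
    refine (tendsto_min_mul_sqrt (hε (k + 1) hi) _).div (tendsto_tsum_min_mul_sqrt
      (fun j => hε (j + 1) (by omega)) (fun j => by positivity)
      (summable_geometric_of_lt_one ha0.le ha1)) ?_
    rw [tsum_mul_left, tsum_geometric_of_lt_one ha0.le ha1]
    have := sub_pos.2 ha1
    positivity
  have hval : (1 - a) * a ^ (k + 1 - 1) = (2 * a ^ k) / ∑' j, 2 * a ^ j := by
    rw [tsum_mul_left, tsum_geometric_of_lt_one ha0.le ha1, Nat.add_sub_cancel,
      mul_div_mul_left _ _ two_ne_zero, div_inv_eq_mul, mul_comm]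
  rw [hval]
  refine hlim.congr' ?_
  filter_upwards [eventually_gt_atTop 0] with u hu
  rw [← hvol k u hu, ← htotal u hu, mul_div_mul_left _ _ (Real.sqrt_pos.2 hu).ne']
end

section
/- For each N ∈ ℕ, lim_{u→∞} Leb({x : ψ(x) > u} \ ⋃_{i=1}^{N} {x ∈ B_{εᵢ}(ξᵢ) : ψ(x) > u}) / Leb({x : ψ(x) > u}) = (1/√2)^{N}; in particular these limits tend to 0 as N → ∞, so the truncated exceedance sets Ũ_n capture asymptotically all of the exceedance set U_n whenever the truncation level N(n) tends to infinity. -/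
open MeasureTheory Filter Set

/-- The exceedance set of `c * |x - a| ^ (-2)` in a ball is a punctured ball. -/
theorem exceedance_ball_eq {a e q u : ℝ} (hq : 0 < q) (hu : 0 < u) :
    {x ∈ Metric.ball a e | (q ^ 2) * |x - a| ^ (-2 : ℤ) > u} =
      Metric.ball a (min e (q / √u)) \ {a} := by
  ext x
  simp only [Metric.mem_ball, mem_ofPred_eq, Set.mem_sdiff, mem_singleton_iff, lt_min_iff,
    Real.dist_eq]
  rw [and_assoc]
  refine and_congr_right fun _ => ?_
  have hs : 0 < √u := Real.sqrt_pos.2 hu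
  rcases eq_or_ne x a with rfl | hxa
  · simp [hu.le]
  · have hd : 0 < |x - a| := abs_pos.2 (sub_ne_zero.2 hxa)
    simp only [hxa, not_false_eq_true, and_true]
    have h1 : q ^ 2 * |x - a| ^ (-2 : ℤ) = q ^ 2 / |x - a| ^ 2 := by
      rw [zpow_neg, div_eq_mul_inv]
      norm_cast
    rw [h1, gt_iff_lt, lt_div_iff₀ (by positivity), lt_div_iff₀ hs]
    have h2 : u * |x - a| ^ 2 = (|x - a| * √u) ^ 2 := by
      rw [mul_pow, Real.sq_sqrt hu.le, mul_comm]
    rw [h2]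
    exact pow_lt_pow_iff_left₀ (by positivity) hq.le two_ne_zero

/-- Rescaled total length of the balls of radius `min (e k) (b k / √u)`. -/
theorem tendsto_sqrt_mul_tsum_min {e b : ℕ → ℝ} (he : ∀ k, 0 < e k) (hb : ∀ k, 0 ≤ b k)
    (hsum : Summable b) :
    Tendsto (fun u : ℝ => √u * ∑' k, 2 * min (e k) (b k / √u)) atTop (nhds (∑' k, 2 * b k)) := by
  simp_rw [← tsum_mul_left (a := √_)]
  refine tendsto_tsum_of_dominated_convergence (bound := fun k => 2 * b k)
    (hsum.mul_left 2) (fun k => ?_) ?_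
  · have h : Tendsto (fun u : ℝ => √u * e k) atTop atTop :=
      Real.tendsto_sqrt_atTop.atTop_mul_const (he k)
    refine tendsto_const_nhds.congr' ?_
    filter_upwards [h.eventually_ge_atTop (b k), eventually_gt_atTop 0] with u hu hu0
    have hs : 0 < √u := Real.sqrt_pos.2 hu0
    rw [min_eq_right ((div_le_iff₀ hs).2 (by linarith))]
    field_simp
  · filter_upwards [eventually_gt_atTop 0] with u hu0 k
    have hs : 0 < √u := Real.sqrt_pos.2 hu0
    have hm : 0 ≤ min (e k) (b k / √u) := le_min (he k).le (div_nonneg (hb k) hs.le)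
    rw [Real.norm_of_nonneg (by positivity)]
    have h := mul_le_mul_of_nonneg_left (min_le_right (e k) (b k / √u)) hs.le
    rw [mul_div_cancel₀ _ hs.ne'] at h
    linarith

/-- Measure of a disjoint union of punctured balls. -/
theorem volume_iUnion_punctured_ball {a r : ℕ → ℝ} (hr : ∀ k, 0 ≤ r k)
    (hd : Pairwise fun j k => Disjoint (Metric.ball (a j) (r j) \ {a j})
      (Metric.ball (a k) (r k) \ {a k})) :
    (volume (⋃ k, Metric.ball (a k) (r k) \ {a k})).toReal = ∑' k, 2 * r k := by
  rw [measure_iUnion hd fun k => measurableSet_ball.diff (measurableSet_singleton _)]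
  have h : ∀ k, volume (Metric.ball (a k) (r k) \ {a k}) = ENNReal.ofReal (2 * r k) := fun k => by
    rw [measure_sdiff_null (by simp), Real.volume_ball]
  simp_rw [h]
  rw [ENNReal.tsum_toReal_eq fun k => ENNReal.ofReal_ne_top]
  exact tsum_congr fun k => ENNReal.toReal_ofReal (mul_nonneg zero_le_two (hr k))

/-- for each `N ∈ ℕ`,
`lim_{u→∞} Leb({ψ > u} \ ⋃_{i=1}^{N} {x ∈ B_{εᵢ}(ξᵢ) : ψ(x) > u}) / Leb({ψ > u})
  = (1/√2)^N`. -/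
theorem stmt10
    (ε : ℕ → ℝ) (hε : ∀ i, 1 ≤ i → 0 < ε i)
    (hdisj : ∀ i j, 1 ≤ i → 1 ≤ j → i ≠ j →
      Disjoint (Metric.ball (xiT i) (ε i)) (Metric.ball (xiT j) (ε j)))
    (hsub : ∀ i, 1 ≤ i → Metric.ball (xiT i) (ε i) ⊆ Ioo (0:ℝ) 1)
    (ψ : ℝ → ℝ)
    (hψ : ∀ i, 1 ≤ i → ∀ x ∈ Metric.ball (xiT i) (ε i),
      ψ x = ((2 : ℝ) ^ (i - 1))⁻¹ * |x - xiT i| ^ (-2 : ℤ))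
    (hψ₀ : ∀ x, (∀ i, 1 ≤ i → x ∉ Metric.ball (xiT i) (ε i)) → ψ x = 0)
    (N : ℕ) :
    Tendsto
      (fun u : ℝ =>
        (volume ({x ∈ Icc (0:ℝ) 1 | ψ x > u} \
            ⋃ i ∈ Finset.Icc 1 N, {x ∈ Metric.ball (xiT i) (ε i) | ψ x > u})).toReal /
          (volume {x ∈ Icc (0:ℝ) 1 | ψ x > u}).toReal)
      atTop
      (nhds ((1 / Real.sqrt 2) ^ N)) := by
  set q : ℝ := 1 / √2 with hq
  have hq0 : 0 < q := by positivity
  have hq1 : q < 1 := by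
    rw [hq, div_lt_one (by positivity)]
    exact Real.lt_sqrt_of_sq_lt (by norm_num)
  have hq2 : ∀ k : ℕ, ((2 : ℝ) ^ k)⁻¹ = (q ^ k) ^ 2 := fun k => by
    rw [← pow_mul, mul_comm, pow_mul, hq, div_pow, Real.sq_sqrt zero_le_two, one_pow, one_div,
      inv_pow]
  have hball : ∀ u : ℝ, 0 < u → ∀ k : ℕ,
      {x ∈ Metric.ball (xiT (k + 1)) (ε (k + 1)) | ψ x > u} =
        Metric.ball (xiT (k + 1)) (min (ε (k + 1)) (q ^ k / √u)) \ {xiT (k + 1)} := by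
    intro u hu k
    rw [← exceedance_ball_eq (pow_pos hq0 k) hu]
    ext x
    refine and_congr_right fun hx => ?_
    rw [hψ (k + 1) (by omega) x hx, Nat.add_sub_cancel, hq2]
  have hset : ∀ u : ℝ, 0 < u → ∀ M : ℕ, ({x ∈ Icc (0:ℝ) 1 | ψ x > u} \
      ⋃ i ∈ Finset.Icc 1 M, {x ∈ Metric.ball (xiT i) (ε i) | ψ x > u}) =
      ⋃ k : ℕ, {x ∈ Metric.ball (xiT (k + M + 1)) (ε (k + M + 1)) | ψ x > u} := by
    intro u hu M
    ext x
    simp only [Set.mem_sdiff, mem_ofPred_eq, mem_iUnion, Finset.mem_Icc, exists_prop, not_exists,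
      not_and]
    constructor
    · rintro ⟨⟨-, hxu⟩, hx⟩
      by_cases h : ∃ i, 1 ≤ i ∧ x ∈ Metric.ball (xiT i) (ε i)
      · obtain ⟨i, hi, hxi⟩ := h
        have hMi : M < i := by
          by_contra hMi
          exact hx i ⟨hi, not_lt.1 hMi⟩ hxi hxu
        refine ⟨i - M - 1, ?_⟩
        rw [show i - M - 1 + M + 1 = i by omega]
        exact ⟨hxi, hxu⟩
      · have := hψ₀ x fun i hi hxi => h ⟨i, hi, hxi⟩
        linarith
    · rintro ⟨k, hxk, hxu⟩
      refine ⟨⟨Ioo_subset_Icc_self (hsub _ (by omega) hxk), hxu⟩, fun i hi hxi => ?_⟩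
      exact absurd hxk
        (Set.disjoint_left.1 (hdisj i (k + M + 1) hi.1 (by omega) (by omega)) hxi)
  have hlim : ∀ M : ℕ, Tendsto (fun u : ℝ => √u * (volume ({x ∈ Icc (0:ℝ) 1 | ψ x > u} \
      ⋃ i ∈ Finset.Icc 1 M, {x ∈ Metric.ball (xiT i) (ε i) | ψ x > u})).toReal) atTop
      (nhds (q ^ M * (2 * (1 - q)⁻¹))) := by
    intro M
    have hsum : Summable fun k : ℕ => q ^ (k + M) :=
      (summable_nat_add_iff M).2 (summable_geometric_of_lt_one hq0.le hq1)
    have h := tendsto_sqrt_mul_tsum_min (e := fun k => ε (k + M + 1)) (b := fun k => q ^ (k + M))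
      (fun k => hε _ (by omega)) (fun k => by positivity) hsum
    have hval : ∑' k : ℕ, 2 * q ^ (k + M) = q ^ M * (2 * (1 - q)⁻¹) := by
      simp_rw [pow_add]
      rw [tsum_mul_left, tsum_mul_right, tsum_geometric_of_lt_one hq0.le hq1]
      ring
    rw [hval] at h
    refine h.congr' ?_
    filter_upwards [eventually_gt_atTop 0] with u hu
    rw [hset u hu M]
    simp_rw [hball u hu]
    rw [volume_iUnion_punctured_ball (a := fun k => xiT (k + M + 1))
      (r := fun k => min (ε (k + M + 1)) (q ^ (k + M) / √u))]
    · exact fun k => le_min (hε _ (by omega)).le (by positivity)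
    · intro j k hjk
      exact (hdisj (j + M + 1) (k + M + 1) (by omega) (by omega) (by omega)).mono
        (sdiff_subset.trans (Metric.ball_subset_ball (min_le_left _ _)))
        (sdiff_subset.trans (Metric.ball_subset_ball (min_le_left _ _)))
  have hpos : 0 < 2 * (1 - q)⁻¹ := mul_pos two_pos (inv_pos.2 (sub_pos.2 hq1))
  have h0 := hlim 0
  simp only [pow_zero, one_mul, Finset.Icc_eq_empty_of_lt zero_lt_one, Finset.notMem_empty,
    iUnion_of_empty, iUnion_empty, sdiff_empty] at h0
  have h := (hlim N).div h0 hpos.ne'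
  rw [mul_div_cancel_right₀ _ hpos.ne'] at h
  refine h.congr' ?_
  filter_upwards [eventually_gt_atTop 0] with u hu
  exact mul_div_mul_left _ _ (Real.sqrt_pos.2 hu).ne'
end

section
/- For every τ > 0 and all integer sequences (k_n), (q_n) with k_n → ∞, k_n = o(n), q_n → ∞ and q_n = o(r_n), where r_n = ⌊n/k_n⌋, setting U_n = {x ∈ [0,1] : ψ(x) > τ^{−2} · 36 n²}, one has lim_{n→∞} n · Leb( U_n ∩ ⋃_{j=q_n+1}^{r_n−1} f^{−j}(U_n) ) = 0. (Condition D̃'_{q_n} holds for the process X_n = ψ ∘ fⁿ with threshold functions u_n(τ) = τ^{−2}·36n².) -/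
open MeasureTheory Filter Set

theorem fD_iterate_succ (j : ℕ) (x : ℝ) : fD^[j + 1] x = Int.fract (2 ^ (j + 1) * x) := by
  induction j with
  | zero => simp [fD]
  | succ j ih =>
    rw [Function.iterate_succ_apply', ih, fD, Int.fract_eq_fract]
    refine ⟨-(2 * ⌊(2 : ℝ) ^ (j + 1) * x⌋), ?_⟩
    rw [Int.fract]
    push_cast
    ring

/-- The integers at distance at most `R` from `c` number at most `2 * R + 1`. -/
theorem card_Icc_ceil_floor_le (c R : ℝ) (hR : 0 ≤ R) :
    ((Finset.Icc ⌈c - R⌉ ⌊c + R⌋).card : ℝ) ≤ 2 * R + 1 := by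
  have h₁ := Int.le_ceil (c - R)
  have h₂ := Int.floor_le (c + R)
  rw [Int.card_Icc, ← Int.cast_natCast, Int.ofNat_toNat, Int.cast_max, max_le_iff]
  push_cast
  constructor <;> linarith

/-- Points of a `δ`-ball around `a` that `x ↦ fract (N * x)` sends to the `δ`-ball around `b`. -/
theorem measureReal_ball_inter_fract_mem_ball_le (a b δ N : ℝ) (hδ : 0 < δ) (hN : 1 ≤ N) :
    volume.real (Metric.ball a δ ∩ {x | Int.fract (N * x) ∈ Metric.ball b δ}) ≤
      8 * δ ^ 2 + 2 * δ * N⁻¹ := by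
  have hN₀ : 0 < N := one_pos.trans_le hN
  set S := Finset.Icc ⌈N * a - b - δ * (N + 1)⌉ ⌊N * a - b + δ * (N + 1)⌋
  have hcover : Metric.ball a δ ∩ {x | Int.fract (N * x) ∈ Metric.ball b δ} ⊆
      ⋃ m ∈ S, Metric.ball ((m + b) / N) (δ / N) := by
    rintro x ⟨hxa, hxb⟩
    rw [Metric.mem_ball, Real.dist_eq] at hxa
    rw [mem_ofPred_eq, Metric.mem_ball, Real.dist_eq, Int.fract] at hxb
    have hx : |N * x - N * a| < N * δ := by
      rw [← mul_sub, abs_mul, abs_of_pos hN₀]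
      exact mul_lt_mul_of_pos_left hxa hN₀
    rw [abs_lt] at hx
    have hb := abs_lt.1 hxb
    refine mem_iUnion₂.2 ⟨⌊N * x⌋, Finset.mem_Icc.2 ⟨Int.ceil_le.2 ?_, Int.le_floor.2 ?_⟩, ?_⟩
    · linarith
    · linarith
    · rw [Metric.mem_ball, Real.dist_eq,
        show x - (⌊N * x⌋ + b) / N = (N * x - ⌊N * x⌋ - b) / N by field_simp; ring,
        abs_div, abs_of_pos hN₀]
      exact div_lt_div_of_pos_right hxb hN₀
  have hfin : volume (⋃ m ∈ S, Metric.ball (((m : ℝ) + b) / N) (δ / N)) ≠ ⊤ :=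
    ((measure_biUnion_lt_top S.finite_toSet) fun _ _ => measure_ball_lt_top).ne
  calc _ ≤ _ := measureReal_mono hcover hfin
    _ ≤ ∑ m ∈ S, volume.real (Metric.ball (((m : ℝ) + b) / N) (δ / N)) :=
        measureReal_biUnion_finset_le _ _
    _ = S.card * (2 * (δ / N)) := by
        simp [Real.volume_real_ball (div_pos hδ hN₀).le]
    _ ≤ (2 * (δ * (N + 1)) + 1) * (2 * (δ / N)) := by
        gcongr
        exact card_Icc_ceil_floor_le _ _ (by positivity)
    _ ≤ (2 * (δ * (N + N)) + 1) * (2 * (δ / N)) := by gcongr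
    _ = _ := by field_simp; ring

theorem sum_Icc_inv_two_pow_le (q r : ℕ) :
    ∑ j ∈ Finset.Icc (q + 1) (r - 1), ((2 : ℝ) ^ j)⁻¹ ≤ (2 ^ q)⁻¹ := by
  rcases le_or_gt (q + 1) r with h | h
  · have key : ∀ m, ∑ j ∈ Finset.Ico (q + 1) (q + 1 + m), ((2 : ℝ) ^ j)⁻¹ =
        (2 ^ q)⁻¹ - (2 ^ (q + m))⁻¹ := by
      intro m
      induction m with
      | zero => simp
      | succ m ih =>
        rw [← add_assoc, Finset.sum_Ico_succ_top (by omega), ih]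
        field_simp
        ring
    have hI : Finset.Icc (q + 1) (r - 1) = Finset.Ico (q + 1) (q + 1 + (r - (q + 1))) := by
      ext j
      simp only [Finset.mem_Icc, Finset.mem_Ico]
      omega
    rw [hI, key]
    have : (0 : ℝ) ≤ (2 ^ (q + (r - (q + 1))))⁻¹ := by positivity
    linarith
  · rw [Finset.Icc_eq_empty (by omega), Finset.sum_empty]
    positivity

/-- Returns, at times in `[q + 1, r - 1]`, to a set covered by `δ`-balls centred on `C`. -/
theorem measureReal_inter_iUnion_preimage_fD_le (C : Finset ℝ) (δ : ℝ) (hδ : 0 < δ) (q r : ℕ)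
    (V : Set ℝ) (hV : V ⊆ ⋃ c ∈ C, Metric.ball c δ) :
    volume.real (V ∩ ⋃ j ∈ Finset.Icc (q + 1) (r - 1), fD^[j] ⁻¹' V) ≤
      C.card ^ 2 * (8 * δ ^ 2 * r + 2 * δ * (2 ^ q)⁻¹) := by
  set E : ℕ → ℝ × ℝ → Set ℝ := fun j p =>
    Metric.ball p.1 δ ∩ {x | Int.fract (2 ^ j * x) ∈ Metric.ball p.2 δ}
  have hcover : (V ∩ ⋃ j ∈ Finset.Icc (q + 1) (r - 1), fD^[j] ⁻¹' V) ⊆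
      ⋃ j ∈ Finset.Icc (q + 1) (r - 1), ⋃ p ∈ C ×ˢ C, E j p := by
    rintro x ⟨hxV, hx⟩
    obtain ⟨j, hj, hxj⟩ := mem_iUnion₂.1 hx
    obtain ⟨a, ha, hxa⟩ := mem_iUnion₂.1 (hV hxV)
    obtain ⟨b, hb, hxb⟩ := mem_iUnion₂.1 (hV hxj)
    refine mem_iUnion₂.2 ⟨j, hj, mem_iUnion₂.2 ⟨(a, b), Finset.mk_mem_product ha hb, hxa, ?_⟩⟩
    obtain ⟨i, rfl⟩ := Nat.exists_eq_add_of_le' (le_of_add_le_right (Finset.mem_Icc.1 hj).1)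
    rwa [fD_iterate_succ] at hxb
  have hfin : volume (⋃ j ∈ Finset.Icc (q + 1) (r - 1), ⋃ p ∈ C ×ˢ C, E j p) ≠ ⊤ :=
    (measure_biUnion_lt_top (Finset.finite_toSet _) fun _ _ =>
      measure_biUnion_lt_top (Finset.finite_toSet _) fun _ _ =>
        (measure_mono inter_subset_left).trans_lt measure_ball_lt_top).ne
  calc _ ≤ _ := measureReal_mono hcover hfin
    _ ≤ ∑ j ∈ Finset.Icc (q + 1) (r - 1), ∑ p ∈ C ×ˢ C, volume.real (E j p) :=
        (measureReal_biUnion_finset_le _ _).trans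
          (Finset.sum_le_sum fun _ _ => measureReal_biUnion_finset_le _ _)
    _ ≤ ∑ j ∈ Finset.Icc (q + 1) (r - 1), ∑ _p ∈ C ×ˢ C, (8 * δ ^ 2 + 2 * δ * (2 ^ j)⁻¹) :=
        Finset.sum_le_sum fun _ _ => Finset.sum_le_sum fun _ _ =>
          measureReal_ball_inter_fract_mem_ball_le _ _ _ _ hδ (one_le_pow₀ one_le_two)
    _ = C.card ^ 2 * (8 * δ ^ 2 * (Finset.Icc (q + 1) (r - 1)).card +
          2 * δ * ∑ j ∈ Finset.Icc (q + 1) (r - 1), ((2 : ℝ) ^ j)⁻¹) := by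
        simp only [Finset.sum_const, Finset.card_product, nsmul_eq_mul, ← Finset.mul_sum,
          Finset.sum_add_distrib]
        push_cast
        ring
    _ ≤ _ := by
        gcongr
        · rw [Nat.card_Icc]
          omega
        · exact sum_Icc_inv_two_pow_le q r

theorem abs_lt_of_lt_zpow_neg_two (x τ n : ℝ) (hτ : 0 < τ) (hn : 0 < n)
    (h : τ ^ (-2 : ℤ) * (36 * n ^ 2) < |x| ^ (-2 : ℤ)) : |x| < τ / (6 * n) := by
  rw [show τ ^ (-2 : ℤ) * (36 * n ^ 2) = ((τ / (6 * n)) ^ 2)⁻¹ by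
    rw [zpow_neg, zpow_ofNat]; field_simp; norm_num, zpow_neg, zpow_ofNat] at h
  have hδ : 0 < τ / (6 * n) := by positivity
  have hx : 0 < |x| ^ 2 := inv_pos.1 ((by positivity : (0 : ℝ) < _).trans h)
  exact lt_of_pow_lt_pow_left₀ 2 hδ.le ((inv_lt_inv₀ (by positivity) hx).1 h)

/-- condition `D̃'_{qₙ}` holds for `Xₙ = ψ ∘ fⁿ` with the threshold functions
`uₙ(τ) = τ^{−2}·36n²`: for every `τ > 0` and all integer sequences `(kₙ), (qₙ)` with
`kₙ → ∞`, `kₙ = o(n)`, `qₙ → ∞`, `qₙ = o(rₙ)` where `rₙ = ⌊n/kₙ⌋`, setting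
`Uₙ = {x ∈ [0,1] : ψ(x) > τ^{−2}·36n²}`, one has
`lim_{n→∞} n·Leb(Uₙ ∩ ⋃_{j=qₙ+1}^{rₙ−1} f^{−j}(Uₙ)) = 0`. -/
theorem stmt14
    (ε₁ ε₂ ε₃ : ℝ) (hε₁ : 0 < ε₁) (hε₂ : 0 < ε₂) (hε₃ : 0 < ε₃)
    (hd₁₂ : Disjoint (Metric.ball xi1 ε₁) (Metric.ball xi2 ε₂))
    (hd₁₃ : Disjoint (Metric.ball xi1 ε₁) (Metric.ball xi3 ε₃))
    (hd₂₃ : Disjoint (Metric.ball xi2 ε₂) (Metric.ball xi3 ε₃))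
    (hsub : Metric.ball xi1 ε₁ ∪ Metric.ball xi2 ε₂ ∪ Metric.ball xi3 ε₃ ⊆ Ioo (0:ℝ) 1)
    (ψ : ℝ → ℝ)
    (hψ₁ : ∀ x ∈ Metric.ball xi1 ε₁, ψ x = |x - xi1| ^ (-2 : ℤ))
    (hψ₂ : ∀ x ∈ Metric.ball xi2 ε₂, ψ x = |x - xi2| ^ (-2 : ℤ))
    (hψ₃ : ∀ x ∈ Metric.ball xi3 ε₃, ψ x = |x - xi3| ^ (-2 : ℤ))
    (hψ₀ : ∀ x, x ∉ Metric.ball xi1 ε₁ ∪ Metric.ball xi2 ε₂ ∪ Metric.ball xi3 ε₃ → ψ x = 0)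
    (τ : ℝ) (hτ : 0 < τ)
    (k q r : ℕ → ℕ) (hr : ∀ n, r n = n / k n)
    (hk : Tendsto k atTop atTop)
    (hko : (fun n : ℕ => (k n : ℝ)) =o[atTop] (fun n : ℕ => (n : ℝ)))
    (hq : Tendsto q atTop atTop)
    (hqo : (fun n : ℕ => (q n : ℝ)) =o[atTop] (fun n : ℕ => (r n : ℝ)))
    (U : ℕ → Set ℝ)
    (hU : ∀ n : ℕ, U n = {x ∈ Icc (0:ℝ) 1 | ψ x > τ ^ (-2 : ℤ) * (36 * (n : ℝ) ^ 2)}) :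
    Tendsto
      (fun n : ℕ => (n : ℝ) *
        (volume (U n ∩ ⋃ j ∈ Finset.Icc (q n + 1) (r n - 1), fD^[j] ⁻¹' U n)).toReal)
      atTop (nhds 0) := by
  set C : Finset ℝ := {xi1, xi2, xi3}
  have hC : (C.card : ℝ) ≤ 3 := mod_cast Finset.card_le_three
  have hUC : ∀ n : ℕ, 0 < n → U n ⊆ ⋃ c ∈ C, Metric.ball c (τ / (6 * n)) := by
    intro n hn x hx
    have hn' : (0 : ℝ) < n := mod_cast hn
    rw [hU] at hx
    have hψx := hx.2
    by_cases hx' : x ∈ Metric.ball xi1 ε₁ ∪ Metric.ball xi2 ε₂ ∪ Metric.ball xi3 ε₃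
    · rw [mem_iUnion₂]
      rcases hx' with (h | h) | h
      · rw [hψ₁ x h] at hψx
        exact ⟨xi1, by simp [C], abs_lt_of_lt_zpow_neg_two _ _ _ hτ hn' hψx⟩
      · rw [hψ₂ x h] at hψx
        exact ⟨xi2, by simp [C], abs_lt_of_lt_zpow_neg_two _ _ _ hτ hn' hψx⟩
      · rw [hψ₃ x h] at hψx
        exact ⟨xi3, by simp [C], abs_lt_of_lt_zpow_neg_two _ _ _ hτ hn' hψx⟩
    · rw [hψ₀ x hx'] at hψx
      exact absurd hψx (not_lt.2 (by positivity))
  have hlim : Tendsto (fun n => 2 * τ ^ 2 * ((k n : ℝ))⁻¹ + 3 * τ * ((2 : ℝ) ^ q n)⁻¹)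
      atTop (nhds 0) := by
    have h₁ : Tendsto (fun n => ((k n : ℝ))⁻¹) atTop (nhds 0) :=
      tendsto_inv_atTop_zero.comp (tendsto_natCast_atTop_atTop.comp hk)
    have h₂ : Tendsto (fun n => ((2 : ℝ) ^ q n)⁻¹) atTop (nhds 0) :=
      tendsto_inv_atTop_zero.comp ((tendsto_pow_atTop_atTop_of_one_lt one_lt_two).comp hq)
    simpa using (h₁.const_mul (2 * τ ^ 2)).add (h₂.const_mul (3 * τ))
  refine squeeze_zero' (Eventually.of_forall fun n => by positivity) ?_ hlim
  filter_upwards [eventually_gt_atTop 0] with n hn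
  have hn' : (0 : ℝ) < n := mod_cast hn
  have hrn : (r n : ℝ) ≤ n * (k n : ℝ)⁻¹ := by
    rw [hr, ← div_eq_mul_inv]
    exact Nat.cast_div_le
  calc (n : ℝ) * (volume (U n ∩ ⋃ j ∈ Finset.Icc (q n + 1) (r n - 1), fD^[j] ⁻¹' U n)).toReal
      ≤ n * (C.card ^ 2 * (8 * (τ / (6 * n)) ^ 2 * r n + 2 * (τ / (6 * n)) * (2 ^ q n)⁻¹)) := by
        gcongr
        exact measureReal_inter_iUnion_preimage_fD_le C _ (by positivity) _ _ _ (hUC n hn)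
    _ ≤ n * (3 ^ 2 * (8 * (τ / (6 * n)) ^ 2 * (n * (k n : ℝ)⁻¹) +
          2 * (τ / (6 * n)) * (2 ^ q n)⁻¹)) := by gcongr
    _ = 2 * τ ^ 2 * ((k n : ℝ))⁻¹ + 3 * τ * ((2 : ℝ) ^ q n)⁻¹ := by
        field_simp
        ring
end

section
/- Fix an integer t ≥ 0 and τ > 0; let a_n = 36 n² and define V_n : [0,1] → [0,∞]^{t+1} by (V_n(x))_j = τ^{−1} (ψ(f^j(x))/a_n)^{−1/2} for 0 ≤ j ≤ t, with the convention that the value is ∞ when ψ(f^j(x)) = 0. Then the law of V_n under Leb conditioned on the event {x : ψ(x) > τ^{−2} a_n} converges weakly, as n → ∞, to the law of the random vector (Y_j)_{0≤j≤t} defined as follows: let U be uniform on [0,1] and, independently, K uniform on {1,2,3}; if K = 1 then Y₀ = U, Y₁ = 2U, Y₃ = 8U and Y_j = ∞ for all other j ≤ t; if K = 2 then Y₀ = U, Y₂ = 4U and Y_j = ∞ for all other j ≤ t; if K = 3 then Y₀ = U and Y_j = ∞ for all 1 ≤ j ≤ t. (These are the forward finite-dimensional distributions of the piling process, which consists of the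 three equally likely bi-infinite sequences (…,∞,U,2U,∞,8U,∞,…), (…,∞,U,∞,4U,∞,…), (…,∞,U,∞,…).) -/
open MeasureTheory Filter Set
open scoped ENNReal

/-- The uniform distribution on `[0,1]`. -/
noncomputable def unif01 : Measure ℝ := volume.restrict (Icc (0:ℝ) 1)

/-- Branch `K = 1` of the limit: `Y₀ = U`, `Y₁ = 2U`, `Y₃ = 8U`, `Y_j = ∞` otherwise. -/
noncomputable def g1 (t : ℕ) : ℝ → (Fin (t + 1) → ℝ≥0∞) := fun u j =>
  if (j : ℕ) = 0 then ENNReal.ofReal u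
  else if (j : ℕ) = 1 then ENNReal.ofReal (2 * u)
  else if (j : ℕ) = 3 then ENNReal.ofReal (8 * u)
  else ⊤

/-- Branch `K = 2` of the limit: `Y₀ = U`, `Y₂ = 4U`, `Y_j = ∞` otherwise. -/
noncomputable def g2 (t : ℕ) : ℝ → (Fin (t + 1) → ℝ≥0∞) := fun u j =>
  if (j : ℕ) = 0 then ENNReal.ofReal u
  else if (j : ℕ) = 2 then ENNReal.ofReal (4 * u)
  else ⊤

/-- Branch `K = 3` of the limit: `Y₀ = U`, `Y_j = ∞` for `j ≥ 1`. -/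
noncomputable def g3 (t : ℕ) : ℝ → (Fin (t + 1) → ℝ≥0∞) := fun u j =>
  if (j : ℕ) = 0 then ENNReal.ofReal u else ⊤

/-- The law of the random vector `(Y_j)_{0 ≤ j ≤ t}`: the three branches are equally likely
and driven by a uniform random variable `U` on `[0,1]`. -/
noncomputable def limitLaw15 (t : ℕ) : Measure (Fin (t + 1) → ℝ≥0∞) :=
  ((1 : ℝ≥0∞) / 3) • unif01.map (g1 t) + ((1 : ℝ≥0∞) / 3) • unif01.map (g2 t) +
    ((1 : ℝ≥0∞) / 3) • unif01.map (g3 t)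

theorem iterate_fD_of_mem_Ico {x : ℝ} (hx : x ∈ Ico (0 : ℝ) 1) (j : ℕ) :
    fD^[j] x = Int.fract (2 ^ j * x) := by
  induction j with
  | zero => simp [Int.fract_eq_self.2 hx]
  | succ j ih =>
    rw [Function.iterate_succ_apply', ih, fD, Int.fract_eq_fract]
    refine ⟨-(2 * ⌊(2 : ℝ) ^ j * x⌋), ?_⟩
    rw [Int.fract]
    push_cast
    ring

theorem measurable_fD : Measurable fD :=
  measurable_fract.comp (measurable_const_mul (2 : ℝ))

theorem eventually_fract_add {y : ℝ} (hy : ∀ z : ℤ, y ≠ z) :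
    ∀ᶠ h in nhds (0 : ℝ), Int.fract (y + h) = Int.fract y + h := by
  have h0 : 0 < Int.fract y :=
    (Int.fract_nonneg y).lt_of_ne fun h => hy ⌊y⌋ (by rw [Int.fract] at h; linarith)
  have h1 := Int.fract_lt_one y
  have hmem : Ioo (-Int.fract y) (1 - Int.fract y) ∈ nhds (0 : ℝ) :=
    Ioo_mem_nhds (by linarith) (by linarith)
  filter_upwards [hmem] with h hh
  rw [Int.fract_eq_iff]
  refine ⟨by linarith [hh.1], by linarith [hh.2], ⌊y⌋, ?_⟩
  rw [Int.fract]
  ring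

/-- If `E n` is, up to null sets, a disjoint union of balls of a common radius `δ n → 0` around
finitely many points, and the rescaled functions `s ↦ F n (c i + δ n * s)` converge pointwise
to `G i |s|`, then the averages of `F n` over `E n` converge to the average of the `∫₀¹ G i`. -/
theorem tendsto_integral_cond_iUnion_ball {ι : Type*} [Fintype ι] [Nonempty ι]
    (c : ι → ℝ) (δ : ℕ → ℝ) (E : ℕ → Set ℝ) (F : ℕ → ℝ → ℝ) (G : ι → ℝ → ℝ) (C : ℝ)
    (hδ : ∀ᶠ n in atTop, 0 < δ n)
    (hd : ∀ᶠ n in atTop, Pairwise fun i j =>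
      Disjoint (Metric.ball (c i) (δ n)) (Metric.ball (c j) (δ n)))
    (hE : ∀ᶠ n in atTop, E n =ᵐ[volume] ⋃ i, Metric.ball (c i) (δ n))
    (hF : ∀ n, Measurable (F n)) (hC : ∀ n x, |F n x| ≤ C)
    (hlim : ∀ i s, s ≠ 0 → Tendsto (fun n => F n (c i + δ n * s)) atTop (nhds (G i |s|))) :
    Tendsto (fun n => ∫ x, F n x ∂(ProbabilityTheory.cond volume (E n))) atTop
      (nhds (∑ i, (Fintype.card ι : ℝ)⁻¹ * ∫ s in Icc (0 : ℝ) 1, G i s)) := by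
  have key : ∀ i, Tendsto (fun n => ∫ s in (-1 : ℝ)..1, F n (c i + δ n * s)) atTop
      (nhds (∫ s in (-1 : ℝ)..1, G i |s|)) := by
    intro i
    refine intervalIntegral.tendsto_integral_filter_of_dominated_convergence (fun _ => C)
      (Eventually.of_forall fun n => ?_) (Eventually.of_forall fun n => ?_) ?_ ?_
    · exact ((hF n).comp (by fun_prop)).aestronglyMeasurable
    · exact Eventually.of_forall fun s _ => hC n _
    · exact intervalIntegrable_const
    · filter_upwards [(Set.finite_singleton (0 : ℝ)).countable.ae_notMem volume] with s hs _
      exact hlim i s hs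
  have habs : ∀ i, ∫ s in (-1 : ℝ)..1, G i |s| = 2 * ∫ s in Icc (0 : ℝ) 1, G i s := by
    intro i
    rw [intervalIntegral.integral_of_le (by norm_num), integral_Icc_eq_integral_Ioc,
      integral_Ioc_eq_integral_Ioo,
      ← integral_indicator measurableSet_Ioo, ← integral_indicator measurableSet_Ioc]
    have h := integral_comp_abs (f := (Iio (1 : ℝ)).indicator (G i))
    rw [setIntegral_indicator measurableSet_Iio, Ioi_inter_Iio, ← integral_Ioc_eq_integral_Ioo,
      ← integral_indicator measurableSet_Ioc] at h
    rw [← h]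
    congr 1 with s
    by_cases hs : |s| < 1
    · rw [indicator_of_mem (show s ∈ Ioo (-1 : ℝ) 1 from abs_lt.1 hs),
        indicator_of_mem (show |s| ∈ Iio (1 : ℝ) from hs)]
    · rw [indicator_of_notMem (show s ∉ Ioo (-1 : ℝ) 1 from fun h => hs (abs_lt.2 h)),
        indicator_of_notMem (show |s| ∉ Iio (1 : ℝ) from hs)]
  have hsum := tendsto_finsetSum Finset.univ fun i _ =>
    (key i).const_mul ((Fintype.card ι : ℝ)⁻¹ * 2⁻¹)
  simp only [habs] at hsum
  have hconst : ∀ i, (Fintype.card ι : ℝ)⁻¹ * 2⁻¹ * (2 * ∫ s in Icc (0 : ℝ) 1, G i s) =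
      (Fintype.card ι : ℝ)⁻¹ * ∫ s in Icc (0 : ℝ) 1, G i s := fun i => by ring
  simp only [hconst] at hsum
  refine hsum.congr' ?_
  filter_upwards [hδ, hd, hE] with n hδn hdn hEn
  have hvol : volume (E n) = ENNReal.ofReal (Fintype.card ι * (2 * δ n)) := by
    rw [measure_congr hEn, measure_iUnion hdn fun i => Metric.isOpen_ball.measurableSet,
      tsum_fintype]
    simp only [Real.volume_ball, Finset.sum_const, Finset.card_univ, nsmul_eq_mul]
    rw [ENNReal.ofReal_mul (p := (Fintype.card ι : ℝ)) (by positivity), ENNReal.ofReal_natCast]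
  have hU : (⋃ i, Metric.ball (c i) (δ n)) = ⋃ i ∈ Finset.univ, Metric.ball (c i) (δ n) := by
    simp
  rw [ProbabilityTheory.cond, integral_smul_measure, hvol,
    Measure.restrict_congr_set hEn, hU,
    integral_biUnion_finset _ (fun i _ => Metric.isOpen_ball.measurableSet)
      (fun i _ j _ hij => hdn hij), Finset.smul_sum]
  · refine Finset.sum_congr rfl fun i _ => ?_
    rw [intervalIntegral.integral_comp_add_mul _ hδn.ne', Real.ball_eq_Ioo,
      ← integral_Ioc_eq_integral_Ioo, ← intervalIntegral.integral_of_le (by linarith),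
      ENNReal.toReal_inv, ENNReal.toReal_ofReal (by positivity)]
    simp only [smul_eq_mul, mul_neg, mul_one, ← sub_eq_add_neg]
    field_simp
  · intro i _
    refine Integrable.mono' (g := fun _ => C) ?_ (hF n).aestronglyMeasurable
      (Eventually.of_forall fun x => hC n x)
    exact integrableOn_const measure_ball_lt_top.ne

/-- The maximal points are `ξᵢ = f^[maximalExp i] ζ`. -/
def maximalExp : Fin 3 → ℕ := ![0, 1, 3]

/-- The maximal points `ξ₁, ξ₂, ξ₃`, as multiples of `ζ` by powers of `2`. -/
noncomputable def maximalPt (i : Fin 3) : ℝ := 2 ^ maximalExp i * (Real.sqrt 2 / 16)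

/-- The `i`-th branch of the piling process driven by the value `s`. -/
noncomputable def pilingBranch (t : ℕ) (i : Fin 3) (s : ℝ) : Fin (t + 1) → ℝ≥0∞ := fun j =>
  if ∃ k, (j : ℕ) + maximalExp i = maximalExp k then ENNReal.ofReal (2 ^ (j : ℕ) * s) else ⊤

theorem maximalPt_zero : maximalPt 0 = xi1 := by simp [maximalPt, maximalExp, xi1]

theorem maximalPt_one : maximalPt 1 = xi2 := by simp [maximalPt, maximalExp, xi2]; ring

theorem maximalPt_two : maximalPt 2 = xi3 := by simp [maximalPt, maximalExp, xi3]; ring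

theorem exists_maximalExp_eq_iff (a : ℕ) : (∃ k, a = maximalExp k) ↔ a = 0 ∨ a = 1 ∨ a = 3 := by
  simp [Fin.exists_fin_succ, maximalExp]

theorem pilingBranch_zero (t : ℕ) : pilingBranch t 0 = g1 t := by
  funext s j
  have hiff : (∃ k, (j : ℕ) + maximalExp 0 = maximalExp k) ↔ (j : ℕ) = 0 ∨ (j : ℕ) = 1 ∨ (j : ℕ) = 3 := by
    rw [exists_maximalExp_eq_iff, show maximalExp 0 = 0 from rfl]
    omega
  simp only [pilingBranch, hiff, g1]
  split_ifs <;> first | omega | rfl | (simp only [*]; norm_num)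

theorem pilingBranch_one (t : ℕ) : pilingBranch t 1 = g2 t := by
  funext s j
  have hiff : (∃ k, (j : ℕ) + maximalExp 1 = maximalExp k) ↔ (j : ℕ) = 0 ∨ (j : ℕ) = 2 := by
    rw [exists_maximalExp_eq_iff, show maximalExp 1 = 1 from rfl]
    omega
  simp only [pilingBranch, hiff, g2]
  split_ifs <;> first | omega | rfl | (simp only [*]; norm_num)

theorem pilingBranch_two (t : ℕ) : pilingBranch t 2 = g3 t := by
  funext s j
  have hiff : (∃ k, (j : ℕ) + maximalExp 2 = maximalExp k) ↔ (j : ℕ) = 0 := by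
    rw [exists_maximalExp_eq_iff, show maximalExp 2 = 3 from rfl]
    omega
  simp only [pilingBranch, hiff, g3]
  split_ifs <;> first | omega | rfl | (simp only [*]; norm_num)

theorem measurable_pilingBranch (t : ℕ) (i : Fin 3) : Measurable (pilingBranch t i) := by
  refine measurable_pi_lambda _ fun j => ?_
  unfold pilingBranch
  split_ifs
  · fun_prop
  · exact measurable_const

theorem limitLaw15_eq_sum (t : ℕ) :
    limitLaw15 t = ∑ i, ((1 : ℝ≥0∞) / 3) • unif01.map (pilingBranch t i) := by
  rw [Fin.sum_univ_three, pilingBranch_zero, pilingBranch_one, pilingBranch_two, limitLaw15]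

theorem integral_limitLaw15 (t : ℕ)
    (g : BoundedContinuousFunction (Fin (t + 1) → ℝ≥0∞) ℝ) :
    ∫ v, g v ∂(limitLaw15 t) =
      ∑ i, (Fintype.card (Fin 3) : ℝ)⁻¹ * ∫ s in Icc (0 : ℝ) 1, g (pilingBranch t i s) := by
  have : IsFiniteMeasure unif01 := by unfold unif01; infer_instance
  rw [limitLaw15_eq_sum, integral_finsetSum_measure]
  · refine Finset.sum_congr rfl fun i _ => ?_
    rw [integral_smul_measure, integral_map (measurable_pilingBranch t i).aemeasurable
      g.continuous.measurable.aestronglyMeasurable]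
    simp [unif01]
  · intro i _
    exact (g.integrable _).smul_measure (by simp)

theorem eq_zero_of_intCast_mul_sqrt_two_div {q z : ℤ} (h : (q : ℝ) * (Real.sqrt 2 / 16) = z) :
    q = 0 := by
  by_contra hq
  refine (irrational_sqrt_two.intCast_mul hq).ne_int (16 * z) ?_
  push_cast
  linarith

theorem two_pow_mul_maximalPt (j : ℕ) (i : Fin 3) :
    2 ^ j * maximalPt i = 2 ^ (j + maximalExp i) * (Real.sqrt 2 / 16) := by
  rw [maximalPt, pow_add, mul_assoc]

theorem two_pow_mul_maximalPt_ne_intCast (j : ℕ) (i : Fin 3) (z : ℤ) :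
    2 ^ j * maximalPt i ≠ z := by
  intro h
  rw [two_pow_mul_maximalPt] at h
  have := eq_zero_of_intCast_mul_sqrt_two_div (q := 2 ^ (j + maximalExp i)) (z := z)
    (by push_cast; exact h)
  exact pow_ne_zero _ two_ne_zero this

theorem maximalExp_eq_of_fract_eq {j : ℕ} {i k : Fin 3}
    (h : Int.fract (2 ^ j * maximalPt i) = maximalPt k) :
    j + maximalExp i = maximalExp k := by
  rw [Int.fract, two_pow_mul_maximalPt, maximalPt] at h
  have := eq_zero_of_intCast_mul_sqrt_two_div
    (q := 2 ^ (j + maximalExp i) - 2 ^ maximalExp k)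
    (z := ⌊(2 : ℝ) ^ (j + maximalExp i) * (Real.sqrt 2 / 16)⌋) (by push_cast; linarith)
  exact Nat.pow_right_injective le_rfl (by exact_mod_cast sub_eq_zero.1 this)

/-- The threshold inverse `u_n⁻¹`, normalised by `τ`, turns `ψ` near a maximal point into the
distance to that point, in units of the radius `τ / (6 n)`. -/
theorem inv_mul_zpow_div_rpow {τ z : ℝ} (hτ : 0 < τ) (hz : 0 < z) {n : ℕ} (hn : 0 < n) :
    τ⁻¹ * (z ^ (-2 : ℤ) / (36 * (n : ℝ) ^ 2)) ^ (-(1/2) : ℝ) = z / (τ / (6 * n)) := by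
  have hn' : (0 : ℝ) < n := by exact_mod_cast hn
  have : z ^ (-2 : ℤ) / (36 * (n : ℝ) ^ 2) = ((6 * n * z) ^ 2)⁻¹ := by
    rw [zpow_neg]
    field_simp
    norm_cast
  rw [this, Real.rpow_neg (by positivity), ← Real.sqrt_eq_rpow, Real.sqrt_inv,
    Real.sqrt_sq (by positivity)]
  field_simp

theorem tendsto_radius (τ : ℝ) : Tendsto (fun n : ℕ => τ / (6 * n)) atTop (nhds 0) :=
  tendsto_const_nhds.div_atTop
    (tendsto_natCast_atTop_atTop.const_mul_atTop (by norm_num : (0 : ℝ) < 6))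

/-- The value of the rescaled observable, with the convention `∞` where `ψ` vanishes. -/
noncomputable def rescaled (ψ : ℝ → ℝ) (τ : ℝ) (n : ℕ) (y : ℝ) : ℝ≥0∞ :=
  if ψ y = 0 then ⊤ else ENNReal.ofReal (τ⁻¹ * (ψ y / (36 * (n : ℝ) ^ 2)) ^ (-(1/2) : ℝ))

/-- `ψ` is `|x - ξᵢ|⁻²` on the balls `B_{ε i}(ξᵢ)`, which are pairwise disjoint and contained
in `(0, 1)`, and vanishes elsewhere. -/
structure IsPilingObservable (ψ : ℝ → ℝ) (ε : Fin 3 → ℝ) : Prop where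
  pos : ∀ i, 0 < ε i
  disjoint : Pairwise fun i k =>
    Disjoint (Metric.ball (maximalPt i) (ε i)) (Metric.ball (maximalPt k) (ε k))
  subset : ∀ i, Metric.ball (maximalPt i) (ε i) ⊆ Ioo (0 : ℝ) 1
  eq_zpow : ∀ i, ∀ x ∈ Metric.ball (maximalPt i) (ε i), ψ x = |x - maximalPt i| ^ (-2 : ℤ)
  eq_zero : ∀ x, (∀ i, x ∉ Metric.ball (maximalPt i) (ε i)) → ψ x = 0

namespace IsPilingObservable

variable {ψ : ℝ → ℝ} {ε : Fin 3 → ℝ}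

theorem maximalPt_mem_Ioo (h : IsPilingObservable ψ ε) (i : Fin 3) :
    maximalPt i ∈ Ioo (0 : ℝ) 1 :=
  h.subset i (Metric.mem_ball_self (h.pos i))

theorem measurable (h : IsPilingObservable ψ ε) : Measurable ψ := by
  have hψ : ψ = fun x => ∑ i, (Metric.ball (maximalPt i) (ε i)).indicator
      (fun x => (|x - maximalPt i| ^ 2)⁻¹) x := by
    funext x
    by_cases hx : ∃ i, x ∈ Metric.ball (maximalPt i) (ε i)
    · obtain ⟨i, hi⟩ := hx
      rw [Finset.sum_eq_single i, indicator_of_mem hi, h.eq_zpow i x hi, zpow_neg]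
      · norm_cast
      · intro k _ hk
        exact indicator_of_notMem (disjoint_left.1 (h.disjoint hk.symm) hi) _
      · simp
    · push Not at hx
      rw [h.eq_zero x hx]
      exact (Finset.sum_eq_zero fun i _ => indicator_of_notMem (hx i) _).symm
  rw [hψ]
  refine Finset.measurable_sum _ fun i _ => ?_
  exact Measurable.indicator (by fun_prop) Metric.isOpen_ball.measurableSet

theorem measurable_rescaled (h : IsPilingObservable ψ ε) (τ : ℝ) (n : ℕ) :
    Measurable (rescaled ψ τ n) := by
  have hψ := h.measurable
  unfold rescaled
  exact Measurable.ite (measurableSet_eq_fun hψ measurable_const) measurable_const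
    (((hψ.div_const _).pow_const _).const_mul _).ennreal_ofReal

theorem rescaled_eq (h : IsPilingObservable ψ ε) {τ : ℝ} (hτ : 0 < τ) {n : ℕ} (hn : 0 < n)
    {i : Fin 3} {y : ℝ} (hy : y ∈ Metric.ball (maximalPt i) (ε i)) (hne : y ≠ maximalPt i) :
    rescaled ψ τ n y = ENNReal.ofReal (|y - maximalPt i| / (τ / (6 * n))) := by
  have hz : 0 < |y - maximalPt i| := abs_pos.2 (sub_ne_zero.2 hne)
  rw [rescaled, h.eq_zpow i y hy, if_neg (zpow_pos hz _).ne', inv_mul_zpow_div_rpow hτ hz hn]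

theorem le_rescaled (h : IsPilingObservable ψ ε) {τ : ℝ} (hτ : 0 < τ) {n : ℕ} (hn : 0 < n)
    {r y : ℝ} (hr : 0 < r) (hy : ∀ i, r < |y - maximalPt i|) :
    ENNReal.ofReal (r / (τ / (6 * n))) ≤ rescaled ψ τ n y := by
  by_cases hx : ∃ i, y ∈ Metric.ball (maximalPt i) (ε i)
  · obtain ⟨i, hi⟩ := hx
    rw [h.rescaled_eq hτ hn hi (sub_ne_zero.1 (abs_pos.1 (hr.trans (hy i))))]
    have := (hy i).le
    gcongr
  · push Not at hx
    simp [rescaled, h.eq_zero y hx]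

theorem eventually_iterate_fD (h : IsPilingObservable ψ ε) (i : Fin 3) (j : ℕ) :
    ∀ᶠ x in nhds (0 : ℝ),
      fD^[j] (maximalPt i + x) = Int.fract (2 ^ j * maximalPt i) + 2 ^ j * x := by
  have h1 : ∀ᶠ x in nhds (0 : ℝ), maximalPt i + x ∈ Ico (0 : ℝ) 1 := by
    have : Tendsto (fun x : ℝ => maximalPt i + x) (nhds 0) (nhds (maximalPt i)) :=
      Continuous.tendsto' (by fun_prop) _ _ (by simp)
    exact this.eventually (Ico_mem_nhds (h.maximalPt_mem_Ioo i).1 (h.maximalPt_mem_Ioo i).2)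
  have h2 : Tendsto (fun x : ℝ => 2 ^ j * x) (nhds 0) (nhds 0) :=
    Continuous.tendsto' (by fun_prop) _ _ (by simp)
  filter_upwards [h1, h2.eventually (eventually_fract_add
    (two_pow_mul_maximalPt_ne_intCast j i))] with x hx hx'
  rw [iterate_fD_of_mem_Ico hx, mul_add, hx']

theorem tendsto_rescaled_iterate (h : IsPilingObservable ψ ε) {τ : ℝ} (hτ : 0 < τ)
    (i : Fin 3) (j : ℕ) {s : ℝ} (hs : s ≠ 0) :
    Tendsto (fun n : ℕ => rescaled ψ τ n (fD^[j] (maximalPt i + τ / (6 * n) * s))) atTop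
      (nhds (if ∃ k, j + maximalExp i = maximalExp k
        then ENNReal.ofReal (2 ^ j * |s|) else ⊤)) := by
  have hδ := tendsto_radius τ
  have hδs : Tendsto (fun n : ℕ => τ / (6 * n) * s) atTop (nhds 0) := by
    simpa using hδ.mul_const s
  have horb := hδs.eventually (h.eventually_iterate_fD i j)
  have hjs : Tendsto (fun n : ℕ => 2 ^ j * (τ / (6 * n) * s)) atTop (nhds 0) := by
    simpa using hδs.const_mul (2 ^ j)
  split_ifs with hk
  · obtain ⟨k, hk⟩ := hk
    have hfr : Int.fract (2 ^ j * maximalPt i) = maximalPt k := by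
      rw [two_pow_mul_maximalPt, hk]
      exact Int.fract_eq_self.2 (Ioo_subset_Ico_self (h.maximalPt_mem_Ioo k))
    refine tendsto_const_nhds.congr' ?_
    filter_upwards [horb, hjs.eventually (Metric.ball_mem_nhds 0 (h.pos k)),
      eventually_gt_atTop 0] with n hn hball hn0
    have hn' : (0 : ℝ) < n := by exact_mod_cast hn0
    rw [hn, hfr, h.rescaled_eq hτ hn0 (i := k)]
    · congr 1
      rw [add_sub_cancel_left, abs_mul, abs_mul, abs_of_pos (by positivity : (0 : ℝ) < 2 ^ j),
        abs_of_pos (by positivity : 0 < τ / (6 * n))]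
      field_simp
    · simpa [Metric.mem_ball, dist_eq_norm] using hball
    · have : 2 ^ j * (τ / (6 * n) * s) ≠ 0 := by positivity
      simpa using this
  · have hpos : ∀ k, 0 < |Int.fract (2 ^ j * maximalPt i) - maximalPt k| := fun k =>
      abs_pos.2 (sub_ne_zero.2 fun hf => hk ⟨k, maximalExp_eq_of_fract_eq hf⟩)
    obtain ⟨r, hr, hrk⟩ : ∃ r : ℝ, 0 < r ∧
        ∀ k, r < |Int.fract (2 ^ j * maximalPt i) - maximalPt k| := by
      have h1 : ∀ᶠ r in nhdsWithin (0 : ℝ) (Ioi 0),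
          ∀ k, r < |Int.fract (2 ^ j * maximalPt i) - maximalPt k| :=
        eventually_all.2 fun k => nhdsWithin_le_nhds (Iio_mem_nhds (hpos k))
      exact ((eventually_mem_nhdsWithin).and h1).exists
    have hfar : ∀ᶠ n : ℕ in atTop, ∀ k,
        r < |Int.fract (2 ^ j * maximalPt i) + 2 ^ j * (τ / (6 * n) * s) - maximalPt k| := by
      refine eventually_all.2 fun k => ?_
      have : Tendsto (fun n : ℕ => |Int.fract (2 ^ j * maximalPt i) +
          2 ^ j * (τ / (6 * n) * s) - maximalPt k|) atTop
          (nhds |Int.fract (2 ^ j * maximalPt i) - maximalPt k|) := by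
        simpa using ((hjs.const_add (Int.fract (2 ^ j * maximalPt i))).sub_const
          (maximalPt k)).abs
      exact this.eventually (Ioi_mem_nhds (hrk k))
    have hlim : Tendsto (fun n : ℕ => r / (τ / (6 * n))) atTop atTop := by
      have : (fun n : ℕ => r / (τ / (6 * n))) = fun n : ℕ => (r * 6 / τ) * (n : ℝ) := by
        funext n
        field_simp
      rw [this]
      exact tendsto_natCast_atTop_atTop.const_mul_atTop (by positivity)
    refine tendsto_nhds_top_mono (ENNReal.tendsto_ofReal_atTop.comp hlim) ?_
    filter_upwards [horb, hfar, eventually_gt_atTop 0] with n hn hn' hn0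
    rw [hn]
    exact h.le_rescaled hτ hn0 hr hn'

theorem eventually_radius_lt (h : IsPilingObservable ψ ε) (τ : ℝ) :
    ∀ᶠ n : ℕ in atTop, ∀ i, τ / (6 * n) < ε i :=
  eventually_all.2 fun i => (tendsto_radius τ).eventually (Iio_mem_nhds (h.pos i))

theorem exceedance_ae_eq (h : IsPilingObservable ψ ε) {τ : ℝ} (hτ : 0 < τ) {n : ℕ} (hn : 0 < n)
    (hε : ∀ i, τ / (6 * n) < ε i) :
    {x ∈ Icc (0 : ℝ) 1 | ψ x > τ ^ (-2 : ℤ) * (36 * (n : ℝ) ^ 2)} =ᵐ[volume]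
      ⋃ i, Metric.ball (maximalPt i) (τ / (6 * n)) := by
  have hn' : (0 : ℝ) < n := by exact_mod_cast hn
  have hthr : τ ^ (-2 : ℤ) * (36 * (n : ℝ) ^ 2) = (τ / (6 * n)) ^ (-2 : ℤ) := by
    rw [zpow_neg, zpow_neg]
    norm_cast
    field_simp
    push_cast
    ring
  have hiff : ∀ i x, x ∈ Metric.ball (maximalPt i) (ε i) → x ≠ maximalPt i →
      (ψ x > (τ / (6 * n)) ^ (-2 : ℤ) ↔ x ∈ Metric.ball (maximalPt i) (τ / (6 * n))) := by
    intro i x hx hne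
    have hz : 0 < |x - maximalPt i| := abs_pos.2 (sub_ne_zero.2 hne)
    rw [h.eq_zpow i x hx, Metric.mem_ball, Real.dist_eq, gt_iff_lt,
      zpow_neg, zpow_neg, inv_lt_inv₀ (by positivity) (by positivity),
      zpow_lt_zpow_iff_left₀ hz.le (by positivity) (by norm_num)]
  filter_upwards [(finite_range maximalPt).countable.ae_notMem volume] with x hx
  have hne : ∀ i, x ≠ maximalPt i := fun i hi => hx ⟨i, hi.symm⟩
  refine propext ?_
  change (x ∈ Icc (0 : ℝ) 1 ∧ ψ x > τ ^ (-2 : ℤ) * (36 * (n : ℝ) ^ 2)) ↔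
    x ∈ ⋃ i, Metric.ball (maximalPt i) (τ / (6 * n))
  rw [hthr, mem_iUnion]
  constructor
  · rintro ⟨-, hψ⟩
    by_cases hb : ∃ i, x ∈ Metric.ball (maximalPt i) (ε i)
    · obtain ⟨i, hi⟩ := hb
      exact ⟨i, (hiff i x hi (hne i)).1 hψ⟩
    · push Not at hb
      rw [h.eq_zero x hb] at hψ
      exact absurd hψ (not_lt.2 (by positivity))
  · rintro ⟨i, hi⟩
    have hi' := Metric.ball_subset_ball (hε i).le hi
    exact ⟨Ioo_subset_Icc_self (h.subset i hi'), (hiff i x hi' (hne i)).2 hi⟩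

theorem tendsto_integral_cond (h : IsPilingObservable ψ ε) {τ : ℝ} (hτ : 0 < τ) (t : ℕ)
    (g : BoundedContinuousFunction (Fin (t + 1) → ℝ≥0∞) ℝ) :
    Tendsto
      (fun n : ℕ => ∫ x, g (fun j : Fin (t + 1) => rescaled ψ τ n (fD^[(j : ℕ)] x))
        ∂(ProbabilityTheory.cond volume
          {x ∈ Icc (0 : ℝ) 1 | ψ x > τ ^ (-2 : ℤ) * (36 * (n : ℝ) ^ 2)}))
      atTop (nhds (∫ v, g v ∂(limitLaw15 t))) := by
  rw [integral_limitLaw15]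
  refine tendsto_integral_cond_iUnion_ball maximalPt (fun n => τ / (6 * n)) _
    (fun n x => g (fun j : Fin (t + 1) => rescaled ψ τ n (fD^[(j : ℕ)] x)))
    (fun i s => g (pilingBranch t i s)) ‖g‖ ?_ ?_ ?_ ?_ ?_ ?_
  · filter_upwards [eventually_gt_atTop 0] with n hn
    positivity
  · filter_upwards [h.eventually_radius_lt τ] with n hn i k hik
    exact (h.disjoint hik).mono (Metric.ball_subset_ball (hn i).le)
      (Metric.ball_subset_ball (hn k).le)
  · filter_upwards [h.eventually_radius_lt τ, eventually_gt_atTop 0] with n hn hn0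
    exact h.exceedance_ae_eq hτ hn0 hn
  · intro n
    refine g.continuous.measurable.comp (measurable_pi_lambda _ fun j => ?_)
    exact (h.measurable_rescaled τ n).comp (measurable_fD.iterate j)
  · exact fun n x => g.norm_coe_le_norm _
  · intro i s hs
    exact (g.continuous.tendsto _).comp
      (tendsto_pi_nhds.2 fun j => h.tendsto_rescaled_iterate hτ i j hs)

end IsPilingObservable

/-- the law of `Vₙ(x) = (τ^{−1}(ψ(f^j x)/36n²)^{−1/2})_{0 ≤ j ≤ t}`
(with value `∞` where `ψ(f^j x) = 0`) under `Leb` conditioned on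
`{ψ > τ^{−2}·36n²}` converges weakly to the law of `(Y_j)_{0 ≤ j ≤ t}`, i.e. the
corresponding integrals of every bounded continuous function converge. -/
theorem stmt15
    (ε₁ ε₂ ε₃ : ℝ) (hε₁ : 0 < ε₁) (hε₂ : 0 < ε₂) (hε₃ : 0 < ε₃)
    (hd₁₂ : Disjoint (Metric.ball xi1 ε₁) (Metric.ball xi2 ε₂))
    (hd₁₃ : Disjoint (Metric.ball xi1 ε₁) (Metric.ball xi3 ε₃))
    (hd₂₃ : Disjoint (Metric.ball xi2 ε₂) (Metric.ball xi3 ε₃))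
    (hsub : Metric.ball xi1 ε₁ ∪ Metric.ball xi2 ε₂ ∪ Metric.ball xi3 ε₃ ⊆ Ioo (0:ℝ) 1)
    (ψ : ℝ → ℝ)
    (hψ₁ : ∀ x ∈ Metric.ball xi1 ε₁, ψ x = |x - xi1| ^ (-2 : ℤ))
    (hψ₂ : ∀ x ∈ Metric.ball xi2 ε₂, ψ x = |x - xi2| ^ (-2 : ℤ))
    (hψ₃ : ∀ x ∈ Metric.ball xi3 ε₃, ψ x = |x - xi3| ^ (-2 : ℤ))
    (hψ₀ : ∀ x, x ∉ Metric.ball xi1 ε₁ ∪ Metric.ball xi2 ε₂ ∪ Metric.ball xi3 ε₃ → ψ x = 0)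
    (t : ℕ) (τ : ℝ) (hτ : 0 < τ)
    (V : ℕ → ℝ → (Fin (t + 1) → ℝ≥0∞))
    (hV : ∀ (n : ℕ) (x : ℝ) (j : Fin (t + 1)),
      V n x j =
        if ψ (fD^[(j : ℕ)] x) = 0 then ⊤
        else ENNReal.ofReal
          (τ⁻¹ * (ψ (fD^[(j : ℕ)] x) / (36 * (n : ℝ) ^ 2)) ^ (-(1/2) : ℝ)))
    (E : ℕ → Set ℝ)
    (hE : ∀ n : ℕ, E n = {x ∈ Icc (0:ℝ) 1 | ψ x > τ ^ (-2 : ℤ) * (36 * (n : ℝ) ^ 2)}) :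
    ∀ g : BoundedContinuousFunction (Fin (t + 1) → ℝ≥0∞) ℝ,
      Tendsto
        (fun n : ℕ => ∫ x, g (V n x) ∂(ProbabilityTheory.cond volume (E n)))
        atTop (nhds (∫ v, g v ∂(limitLaw15 t))) := by
  intro g
  have h : IsPilingObservable ψ ![ε₁, ε₂, ε₃] := by
    constructor
    · simp [Fin.forall_fin_succ, hε₁, hε₂, hε₃]
    · intro i k hik
      fin_cases i <;> fin_cases k <;>
        simp_all [maximalPt_zero, maximalPt_one, maximalPt_two, disjoint_comm]
    · simp only [union_subset_iff] at hsub
      simp [Fin.forall_fin_succ, maximalPt_zero, maximalPt_one, maximalPt_two, hsub]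
    · intro i
      fin_cases i
      · simpa [maximalPt_zero] using hψ₁
      · simpa [maximalPt_one] using hψ₂
      · simpa [maximalPt_two] using hψ₃
    · intro x hx
      refine hψ₀ x ?_
      have h0 := hx 0
      have h1 := hx 1
      have h2 := hx 2
      rw [maximalPt_zero] at h0
      rw [maximalPt_one] at h1
      rw [maximalPt_two] at h2
      rintro ((hx | hx) | hx)
      exacts [h0 hx, h1 hx, h2 hx]
  have hV' : ∀ n x, V n x = fun j : Fin (t + 1) => rescaled ψ τ n (fD^[(j : ℕ)] x) :=
    fun n x => funext fun j => hV n x j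
  simp only [hV', hE]
  exact h.tendsto_integral_cond hτ t g
end

section
/- Fix an integer t ≥ 0 and τ > 0; let a_n = (24 + 16√2) n² and define V_n : [0,1] → [0,∞]^{t+1} by (V_n(x))_j = τ^{−1} (ψ(f^j(x))/a_n)^{−1/2} for 0 ≤ j ≤ t, with the convention that the value is ∞ when ψ(f^j(x)) = 0. Then the law of V_n under Leb conditioned on the event {x : ψ(x) > τ^{−2} a_n} converges weakly, as n → ∞, to the law of the random vector (Y_j)_{0≤j≤t} defined as follows: let U be uniform on [0,1] and, independently, let K ∈ ℕ with P(K = i) = (1 − 1/√2)(1/√2)^{i−1}; given K = i, set m₁ = 0 and m_l = 3^{l−1} for l ≥ 2, and put Y₀ = U, Y_{m_l − m_i} = U · 3^{m_l − m_i} · 2^{(l−i)/2} for each l > i with m_l − m_i ≤ t, and Y_j = ∞ for every other 1 ≤ j ≤ t. (These are the forward finite-dimensional distributions of the piling process of the countable-maximal-set example.) -/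
open MeasureTheory Filter Set
open scoped ENNReal

/-- Branch `K = i` of the limit: `Y₀ = U` and `Y_{m_l − m_i} = U·3^{m_l−m_i}·2^{(l−i)/2}`
for `l ≥ i` (the case `l = i` giving `Y₀ = U`), and `Y_j = ∞` at every other index. -/
noncomputable def gK (t i : ℕ) : ℝ → (Fin (t + 1) → ℝ≥0∞) := fun u j =>
  open Classical in
  if h : ∃ l, i ≤ l ∧ mT l - mT i = (j : ℕ) then
    ENNReal.ofReal (u * 3 ^ (j : ℕ) * Real.sqrt 2 ^ (h.choose - i))
  else ⊤

/-- The law of the random vector `(Y_j)_{0 ≤ j ≤ t}`: branch `K = i` has probability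
`(1 − 1/√2)(1/√2)^{i−1}` (`i ∈ ℕ`, `i ≥ 1`) and is driven by a uniform `U` on `[0,1]`. -/
noncomputable def limitLaw17 (t : ℕ) : Measure (Fin (t + 1) → ℝ≥0∞) :=
  Measure.sum fun i : ℕ =>
    ENNReal.ofReal ((1 - 1 / Real.sqrt 2) * (1 / Real.sqrt 2) ^ i) •
      unif01.map (gK t (i + 1))

lemma fT_iterate {x : ℝ} (hx : x ∈ Ico (0:ℝ) 1) (n : ℕ) : fT^[n] x = Int.fract (3 ^ n * x) := by
  induction n with
  | zero => simpa using (Int.fract_eq_self.2 ⟨hx.1, hx.2⟩).symm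
  | succ n ih =>
    rw [Function.iterate_succ_apply', ih, fT, Int.fract_eq_fract]
    refine ⟨-(3 * ⌊(3:ℝ) ^ n * x⌋), ?_⟩
    rw [Int.fract]
    push_cast
    ring

lemma zetaT_term_le (k j : ℕ) :
    (3 : ℝ) ^ (3 ^ k) * ((3 : ℝ) ^ (3 ^ (j + k + 1)))⁻¹ ≤ (1 / 3) ^ (k + 1) * (1 / 3) ^ j := by
  have h1 : 3 ^ k + (k + 1 + j) ≤ 3 ^ (j + k + 1) := by
    have h2 : j + k < 3 ^ (j + k) := Nat.lt_pow_self (by norm_num)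
    have h3 : 3 ^ k ≤ 3 ^ (j + k) := Nat.pow_le_pow_right (by norm_num) (by omega)
    rw [pow_succ]
    omega
  rw [← pow_add, one_div, inv_pow, ← div_eq_mul_inv, div_le_iff₀ (by positivity),
    inv_mul_eq_div, le_div_iff₀ (by positivity), ← pow_add]
  exact pow_le_pow_right₀ (by norm_num) h1

lemma summable_zetaT : Summable fun j : ℕ => ((3 : ℝ) ^ (3 ^ (j + 1) : ℕ))⁻¹ := by
  refine Summable.of_nonneg_of_le (fun j => by positivity) (fun j => ?_)
    ((summable_geometric_of_lt_one (r := (1 / 3 : ℝ)) (by norm_num) (by norm_num)))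
  have h := zetaT_term_le 0 j
  have h2 : (0:ℝ) < (1 / 3) ^ j := by positivity
  simp only [pow_zero, zero_add, pow_one, add_zero] at h
  linarith

/-- The fractional parts `3^(3^k) ζ mod 1` are positive and decay geometrically. -/
lemma fract_zetaT_mem (k : ℕ) :
    Int.fract ((3:ℝ) ^ (3 ^ k) * zetaT) ∈ Ioc (0:ℝ) ((1 / 3) ^ k) := by
  have hs := (summable_nat_add_iff k).2 summable_zetaT
  have hs' := hs.mul_left ((3:ℝ) ^ (3 ^ k))
  set T : ℝ := ∑' j : ℕ, (3:ℝ) ^ (3 ^ k) * ((3 : ℝ) ^ (3 ^ (j + k + 1) : ℕ))⁻¹ with hT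
  have hT0 : 0 < T := hs'.tsum_pos (fun j => by positivity) 0 (by positivity)
  have hgeo : Summable fun j : ℕ => ((1:ℝ) / 3) ^ (k + 1) * (1 / 3) ^ j :=
    (summable_geometric_of_lt_one (by norm_num) (by norm_num)).mul_left _
  have hp : (0:ℝ) < (1 / 3) ^ k := by positivity
  have hT1 : T < (1 / 3) ^ k := by
    have h := hs'.tsum_le_tsum (fun j => zetaT_term_le k j) hgeo
    rw [← hT, tsum_mul_left, tsum_geometric_of_lt_one (by norm_num) (by norm_num), pow_succ] at h
    linarith
  have hT2 : T < 1 := hT1.trans_le (pow_le_one₀ (by norm_num) (by norm_num))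
  have hsplit : (3:ℝ) ^ (3 ^ k) * zetaT =
      T + ((∑ j ∈ Finset.range k, 3 ^ (3 ^ k - 3 ^ (j + 1)) : ℕ) : ℝ) := by
    rw [zetaT, ← summable_zetaT.sum_add_tsum_nat_add k, mul_add, ← tsum_mul_left, add_comm,
      Finset.mul_sum]
    congr 1
    push_cast
    refine Finset.sum_congr rfl fun j hj => ?_
    have : 3 ^ (j + 1) ≤ 3 ^ k := Nat.pow_le_pow_right (by norm_num) (Finset.mem_range.1 hj)
    rw [pow_sub₀ _ (by norm_num) this]
  rw [hsplit, Int.fract_add_natCast, Int.fract_eq_self.2 ⟨hT0.le, hT2⟩]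
  exact ⟨hT0, hT1.le⟩

lemma irrational_zetaT : Irrational zetaT := by
  rintro ⟨q, hq⟩
  obtain ⟨k, hk⟩ := exists_pow_lt_of_lt_one (x := (1:ℝ) / q.den) (y := 1 / 3)
    (by have := q.pos; positivity) (by norm_num)
  have h := fract_zetaT_mem k
  have hd : (0:ℝ) < q.den := by exact_mod_cast q.pos
  have hz : ∃ z : ℤ, Int.fract ((3:ℝ) ^ (3 ^ k) * zetaT) * q.den = z := by
    refine ⟨3 ^ (3 ^ k) * q.num - ⌊(3:ℝ) ^ (3 ^ k) * zetaT⌋ * q.den, ?_⟩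
    have : zetaT * q.den = q.num := by
      rw [← hq]
      exact_mod_cast Rat.mul_den_eq_num q
    rw [Int.fract]
    push_cast
    linear_combination (3:ℝ) ^ (3 ^ k) * this
  obtain ⟨z, hz⟩ := hz
  have h1 : (0:ℝ) < z := hz ▸ mul_pos h.1 hd
  have h2 : (z:ℝ) < 1 := by
    rw [← hz]
    exact (lt_div_iff₀ hd).1 (h.2.trans_lt hk)
  have h3 : 0 < z := by exact_mod_cast h1
  have h4 : z < 1 := by exact_mod_cast h2
  omega

lemma zetaT_mem : zetaT ∈ Ioo (0:ℝ) 1 := by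
  refine ⟨summable_zetaT.tsum_pos (fun j => by positivity) 0 (by positivity), ?_⟩
  have hgeo : Summable fun j : ℕ => ((1:ℝ) / 3) * (1 / 3) ^ j :=
    (summable_geometric_of_lt_one (by norm_num) (by norm_num)).mul_left _
  have h := summable_zetaT.tsum_le_tsum (g := fun j : ℕ => ((1:ℝ) / 3) * (1 / 3) ^ j)
    (fun j => ?_) hgeo
  · rw [tsum_mul_left, tsum_geometric_of_lt_one (by norm_num) (by norm_num)] at h
    rw [zetaT]
    norm_num at h ⊢
    linarith
  · have h := zetaT_term_le 0 j
    simp only [pow_zero, zero_add, pow_one, add_zero] at h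
    linarith [inv_nonneg.2 (pow_nonneg (zero_le_three (α := ℝ)) (3 ^ (j + 1)))]

lemma fract_pow_mul_zetaT_mem (n : ℕ) : Int.fract ((3:ℝ) ^ n * zetaT) ∈ Ioo (0:ℝ) 1 := by
  refine ⟨(Int.fract_nonneg _).lt_of_ne' fun h => ?_, Int.fract_lt_one _⟩
  have hirr : Irrational (((3 ^ n : ℕ) : ℝ) * zetaT) :=
    irrational_zetaT.natCast_mul (by positivity)
  obtain ⟨z, hz⟩ := Int.fract_eq_zero_iff.1 h
  exact hirr ⟨z, by push_cast; exact hz⟩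

lemma fT_iterate_zetaT (n : ℕ) : fT^[n] zetaT = Int.fract ((3:ℝ) ^ n * zetaT) :=
  fT_iterate (Ioo_subset_Ico_self zetaT_mem) n

lemma fT_iterate_zetaT_mem (n : ℕ) : fT^[n] zetaT ∈ Ioo (0:ℝ) 1 := by
  rw [fT_iterate_zetaT]
  exact fract_pow_mul_zetaT_mem n

lemma fT_iterate_zetaT_injective : Function.Injective fun n => fT^[n] zetaT := by
  intro a b hab
  simp only [fT_iterate_zetaT] at hab
  obtain ⟨z, hz⟩ := Int.fract_eq_fract.1 hab
  by_contra hne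
  have hne' : ((3:ℤ) ^ a - 3 ^ b) ≠ 0 := by
    rw [sub_ne_zero]
    exact fun h => hne (Int.pow_right_injective (a := 3) (by norm_num) h)
  have hirr := irrational_zetaT.intCast_mul hne'
  exact hirr ⟨z, by push_cast; rw [← hz]; ring⟩

/-- Near a point of the orbit of `ζ`, the iterates of the tripling map are affine. -/
lemma fT_iterate_eventually_affine (a j : ℕ) :
    ∀ᶠ x in nhds (fT^[a] zetaT),
      fT^[j] x = fT^[j] (fT^[a] zetaT) + 3 ^ j * (x - fT^[a] zetaT) := by
  set x₀ := fT^[a] zetaT with hx₀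
  have hx₀m : x₀ ∈ Ioo (0:ℝ) 1 := fT_iterate_zetaT_mem a
  have hy : fT^[j] x₀ ∈ Ioo (0:ℝ) 1 := by
    rw [hx₀, ← Function.iterate_add_apply]
    exact fT_iterate_zetaT_mem _
  have hcont : Tendsto (fun x => fT^[j] x₀ + 3 ^ j * (x - x₀)) (nhds x₀) (nhds (fT^[j] x₀)) := by
    have : Continuous fun x => fT^[j] x₀ + 3 ^ j * (x - x₀) := by fun_prop
    simpa using this.tendsto x₀
  filter_upwards [isOpen_Ioo.mem_nhds hx₀m, hcont.eventually (isOpen_Ioo.mem_nhds hy)] with x hx hx'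
  rw [fT_iterate (Ioo_subset_Ico_self hx), ← Int.fract_eq_self.2 ⟨hx'.1.le, hx'.2⟩,
    Int.fract_eq_fract, fT_iterate (Ioo_subset_Ico_self hx₀m)]
  refine ⟨⌊(3:ℝ) ^ j * x₀⌋, ?_⟩
  rw [Int.fract]
  ring

lemma mT_lt_mT {i l : ℕ} (hi : 1 ≤ i) (h : i < l) : mT i < mT l := by
  have hl : l ≠ 1 := by omega
  rw [mT, mT, if_neg hl]
  split_ifs with h1
  · positivity
  · exact Nat.pow_lt_pow_right (by norm_num) (by omega)

lemma mT_injOn {i l : ℕ} (hi : 1 ≤ i) (hl : 1 ≤ l) (h : mT i = mT l) : i = l := by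
  rcases lt_trichotomy i l with h1 | h1 | h1
  · exact absurd h (mT_lt_mT hi h1).ne
  · exact h1
  · exact absurd h (mT_lt_mT hl h1).ne'

lemma tendsto_xiT : Tendsto xiT atTop (nhds 0) := by
  have hgeo : Tendsto (fun i : ℕ => ((1:ℝ) / 3) ^ (i - 1)) atTop (nhds 0) :=
    (tendsto_pow_atTop_nhds_zero_of_lt_one (by norm_num) (by norm_num)).comp
      (tendsto_sub_atTop_nat 1)
  refine squeeze_zero' (Eventually.of_forall fun i => (fT_iterate_zetaT_mem (mT i)).1.le) ?_ hgeo
  filter_upwards [eventually_ge_atTop 2] with i hi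
  have hi1 : i ≠ 1 := by omega
  rw [xiT, mT, if_neg hi1, fT_iterate_zetaT]
  exact (fract_zetaT_mem (i - 1)).2

/-- A point of the orbit of `ζ` that is not a maximal point is isolated from the maximal
points. -/
lemma exists_le_abs_sub_xiT {a : ℕ} (ha : ∀ l, 1 ≤ l → fT^[a] zetaT ≠ xiT l) :
    ∃ d > 0, ∀ l, 1 ≤ l → d ≤ |fT^[a] zetaT - xiT l| := by
  set y := fT^[a] zetaT with hy
  have hy0 : 0 < y := (fT_iterate_zetaT_mem a).1
  have hlim : Tendsto (fun l => |y - xiT (l + 1)|⁻¹) atTop (nhds |y - 0|⁻¹) := by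
    refine Tendsto.inv₀ ?_ (by simpa using hy0.ne')
    exact ((tendsto_const_nhds.sub ((tendsto_add_atTop_iff_nat 1).2 tendsto_xiT))).abs
  obtain ⟨M, hM⟩ := hlim.bddAbove_range
  have hpos : ∀ l, 1 ≤ l → 0 < |y - xiT l| := fun l hl => abs_pos.2 (sub_ne_zero.2 (ha l hl))
  have hle : ∀ l, 1 ≤ l → |y - xiT l|⁻¹ ≤ M := fun l hl =>
    hM ⟨l - 1, by simp only [Nat.sub_add_cancel hl]⟩
  have hM0 : 0 < M := (inv_pos.2 (hpos 1 le_rfl)).trans_le (hle 1 le_rfl)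
  exact ⟨M⁻¹, inv_pos.2 hM0, fun l hl => inv_le_of_inv_le₀ (hpos l hl) (hle l hl)⟩

lemma inv_sq_rpow_neg_half {A : ℝ} (hA : 0 < A) : ((A ^ 2)⁻¹) ^ (-(1/2) : ℝ) = A := by
  rw [Real.inv_rpow (by positivity), Real.rpow_neg (by positivity), inv_inv,
    ← Real.sqrt_eq_rpow, Real.sqrt_sq hA.le]

/-- The normalised height `τ⁻¹ (ψ(y) / a_n)^(-1/2)`, with value `∞` where `ψ` vanishes. -/
noncomputable def heightT (ψ : ℝ → ℝ) (τ : ℝ) (n : ℕ) (y : ℝ) : ℝ≥0∞ :=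
  if ψ y = 0 then ⊤
  else ENNReal.ofReal (τ⁻¹ * (ψ y / ((24 + 16 * Real.sqrt 2) * (n : ℝ) ^ 2)) ^ (-(1/2) : ℝ))

/-- The radius of the component of `{ψ > τ⁻² a_n}` around the `i`-th maximal point, counted
from `0`. -/
noncomputable def radiusT (τ : ℝ) (n i : ℕ) : ℝ :=
  τ / (Real.sqrt (24 + 16 * Real.sqrt 2) * n) * (1 / Real.sqrt 2) ^ i

lemma radiusT_pos {τ : ℝ} (hτ : 0 < τ) {n : ℕ} (hn : n ≠ 0) (i : ℕ) : 0 < radiusT τ n i := by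
  have : (0:ℝ) < n := by positivity
  rw [radiusT]
  positivity

lemma radiusT_sq (τ : ℝ) (n i : ℕ) :
    radiusT τ n i ^ 2 * 2 ^ i * ((24 + 16 * Real.sqrt 2) * (n:ℝ) ^ 2) = if n = 0 then 0 else τ ^ 2 := by
  split_ifs with hn
  · simp [hn]
  · have hn' : (n:ℝ) ≠ 0 := by exact_mod_cast hn
    have hc : (0:ℝ) < 24 + 16 * Real.sqrt 2 := by positivity
    have h1 : Real.sqrt (24 + 16 * Real.sqrt 2) ^ 2 = 24 + 16 * Real.sqrt 2 :=
      Real.sq_sqrt hc.le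
    have h2 : ((1 / Real.sqrt 2) ^ i) ^ 2 * 2 ^ i = 1 := by
      rw [← pow_mul, mul_comm i 2, pow_mul, ← mul_pow, div_pow, Real.sq_sqrt (by norm_num)]
      norm_num
    rw [radiusT, mul_pow, mul_assoc _ _ ((2:ℝ) ^ i), h2, mul_one, div_pow, mul_pow, h1]
    field_simp

lemma tendsto_radiusT (τ : ℝ) (i : ℕ) : Tendsto (fun n => radiusT τ n i) atTop (nhds 0) := by
  have hc : 0 < Real.sqrt (24 + 16 * Real.sqrt 2) := by positivity
  have h := (tendsto_natCast_atTop_atTop (R := ℝ)).const_mul_atTop hc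
  simpa [radiusT] using (h.const_div_atTop τ).mul_const ((1 / Real.sqrt 2) ^ i)

lemma heightT_near_maximal {ε : ℕ → ℝ} {ψ : ℝ → ℝ}
    (hψ : ∀ i, 1 ≤ i → ∀ x ∈ Metric.ball (xiT i) (ε i),
      ψ x = ((2 : ℝ) ^ (i - 1))⁻¹ * |x - xiT i| ^ (-2 : ℤ))
    {τ : ℝ} (hτ : 0 < τ) {n : ℕ} (hn : n ≠ 0) {l : ℕ} {w : ℝ} (hw : w ≠ 0)
    (hball : xiT (l + 1) + radiusT τ n l * w ∈ Metric.ball (xiT (l + 1)) (ε (l + 1))) :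
    heightT ψ τ n (xiT (l + 1) + radiusT τ n l * w) = ENNReal.ofReal |w| := by
  have hr := radiusT_pos hτ hn l
  have hw' : 0 < |w| := abs_pos.2 hw
  have hc : (0:ℝ) < 24 + 16 * Real.sqrt 2 := by positivity
  have hn' : (0:ℝ) < n := by positivity
  have hv := hψ (l + 1) (by omega) _ hball
  rw [add_sub_cancel_left, abs_mul, abs_of_pos hr, add_tsub_cancel_right] at hv
  have hne : ψ (xiT (l + 1) + radiusT τ n l * w) ≠ 0 := by rw [hv]; positivity
  have hsq := radiusT_sq τ n l
  rw [if_neg hn] at hsq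
  have hval : ψ (xiT (l + 1) + radiusT τ n l * w) / ((24 + 16 * Real.sqrt 2) * (n : ℝ) ^ 2) =
      ((τ * |w|) ^ 2)⁻¹ := by
    rw [mul_pow, ← hsq, hv, zpow_neg]
    norm_cast
    field_simp
  rw [heightT, if_neg hne, hval, inv_sq_rpow_neg_half (by positivity), inv_mul_cancel_left₀ hτ.ne']

lemma tendsto_heightT_top {ε : ℕ → ℝ} {ψ : ℝ → ℝ}
    (hψ : ∀ i, 1 ≤ i → ∀ x ∈ Metric.ball (xiT i) (ε i),
      ψ x = ((2 : ℝ) ^ (i - 1))⁻¹ * |x - xiT i| ^ (-2 : ℤ))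
    (hψ₀ : ∀ x, (∀ i, 1 ≤ i → x ∉ Metric.ball (xiT i) (ε i)) → ψ x = 0)
    {τ : ℝ} (hτ : 0 < τ) {a : ℕ} (ha : ∀ l, 1 ≤ l → fT^[a] zetaT ≠ xiT l)
    {y : ℕ → ℝ} (hy : Tendsto y atTop (nhds (fT^[a] zetaT))) :
    Tendsto (fun n => heightT ψ τ n (y n)) atTop (nhds ⊤) := by
  obtain ⟨d, hd, hle⟩ := exists_le_abs_sub_xiT ha
  have hc : (0:ℝ) < 24 + 16 * Real.sqrt 2 := by positivity
  have hbig : Tendsto (fun n : ℕ => ENNReal.ofReal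
      (τ⁻¹ * (d / 2 * Real.sqrt (24 + 16 * Real.sqrt 2)) * n)) atTop (nhds ⊤) := by
    refine ENNReal.tendsto_ofReal_atTop.comp ?_
    exact (tendsto_natCast_atTop_atTop (R := ℝ)).const_mul_atTop (by positivity)
  refine tendsto_nhds_top_mono hbig ?_
  filter_upwards [hy.eventually (Metric.ball_mem_nhds _ (half_pos hd)), eventually_gt_atTop 0]
    with n hn hn0
  rw [heightT]
  split_ifs with h0
  · exact le_top
  refine ENNReal.ofReal_le_ofReal ?_
  rw [mul_assoc]
  refine mul_le_mul_of_nonneg_left ?_ (inv_nonneg.2 hτ.le)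
  obtain ⟨l, hl, hb⟩ : ∃ l, 1 ≤ l ∧ y n ∈ Metric.ball (xiT l) (ε l) := by
    by_contra! hcon
    exact h0 (hψ₀ _ hcon)
  have hdist : d / 2 ≤ |y n - xiT l| := by
    have h1 := hle l hl
    have h2 : |y n - fT^[a] zetaT| < d / 2 := hn
    have h3 := abs_sub_le (fT^[a] zetaT) (y n) (xiT l)
    rw [abs_sub_comm _ (y n)] at h3
    linarith
  have hy0 : 0 < |y n - xiT l| := (half_pos hd).trans_le hdist
  have hn' : (0:ℝ) < n := by exact_mod_cast hn0
  set A : ℝ := d / 2 * Real.sqrt (24 + 16 * Real.sqrt 2) * n with hA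
  have hA0 : 0 < A := by positivity
  have hψpos : 0 < ψ (y n) := by rw [hψ l hl _ hb]; positivity
  have hψle : ψ (y n) ≤ ((d / 2) ^ 2)⁻¹ := by
    have h1 : ((2:ℝ) ^ (l - 1))⁻¹ ≤ 1 := inv_le_one_of_one_le₀ (one_le_pow₀ (by norm_num))
    have h2 : |y n - xiT l| ^ (-2:ℤ) ≤ ((d / 2) ^ 2)⁻¹ := by
      rw [zpow_neg]
      norm_cast
      gcongr
    rw [hψ l hl _ hb]
    calc _ ≤ 1 * ((d / 2) ^ 2)⁻¹ := by gcongr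
      _ = _ := one_mul _
  have hX : ψ (y n) / ((24 + 16 * Real.sqrt 2) * (n : ℝ) ^ 2) ≤ (A ^ 2)⁻¹ := by
    rw [hA, mul_pow, mul_pow, Real.sq_sqrt hc.le, mul_assoc, mul_inv ((d / 2) ^ 2),
      div_eq_mul_inv]
    gcongr
  rw [← inv_sq_rpow_neg_half hA0]
  exact Real.rpow_le_rpow_of_nonpos (by positivity) hX (by norm_num)

/-- Pointwise convergence of the height profile, in the coordinate `u` around each maximal
point. -/
lemma tendsto_heightT_profile {ε : ℕ → ℝ} (hε : ∀ i, 1 ≤ i → 0 < ε i) {ψ : ℝ → ℝ}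
    (hψ : ∀ i, 1 ≤ i → ∀ x ∈ Metric.ball (xiT i) (ε i),
      ψ x = ((2 : ℝ) ^ (i - 1))⁻¹ * |x - xiT i| ^ (-2 : ℤ))
    (hψ₀ : ∀ x, (∀ i, 1 ≤ i → x ∉ Metric.ball (xiT i) (ε i)) → ψ x = 0)
    (t : ℕ) {τ : ℝ} (hτ : 0 < τ) (i : ℕ) {u : ℝ} (hu : u ≠ 0) :
    Tendsto (fun (n : ℕ) (j : Fin (t + 1)) =>
        heightT ψ τ n (fT^[(j : ℕ)] (xiT (i + 1) + radiusT τ n i * u)))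
      atTop (nhds (gK t (i + 1) |u|)) := by
  rw [tendsto_pi_nhds]
  intro j
  have hx : Tendsto (fun n => xiT (i + 1) + radiusT τ n i * u) atTop (nhds (xiT (i + 1))) := by
    simpa using ((tendsto_radiusT τ i).mul_const u).const_add (xiT (i + 1))
  have haff := hx.eventually (fT_iterate_eventually_affine (mT (i + 1)) j)
  change ∀ᶠ n in atTop, _ = fT^[(j:ℕ)] (xiT (i + 1)) + 3 ^ (j:ℕ) * (_ - xiT (i + 1)) at haff
  have hfx : fT^[(j:ℕ)] (xiT (i + 1)) = fT^[(j:ℕ) + mT (i + 1)] zetaT := by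
    rw [xiT, Function.iterate_add_apply]
  have hlin : Tendsto (fun n => fT^[(j:ℕ)] (xiT (i + 1)) + 3 ^ (j:ℕ) * (radiusT τ n i * u)) atTop
      (nhds (fT^[(j:ℕ)] (xiT (i + 1)))) := by
    simpa using (((tendsto_radiusT τ i).mul_const u).const_mul (3 ^ (j:ℕ))).const_add
      (fT^[(j:ℕ)] (xiT (i + 1)))
  have hconv : Tendsto (fun n => fT^[(j:ℕ)] (xiT (i + 1) + radiusT τ n i * u)) atTop
      (nhds (fT^[(j:ℕ)] (xiT (i + 1)))) := by
    refine hlin.congr' ?_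
    filter_upwards [haff] with n hn
    rw [hn, add_sub_cancel_left]
  by_cases h : ∃ l, i + 1 ≤ l ∧ mT l - mT (i + 1) = (j : ℕ)
  · rw [gK, dif_pos h]
    obtain ⟨hl1, hl2⟩ := h.choose_spec
    generalize h.choose = l at hl1 hl2
    obtain ⟨k, rfl⟩ : ∃ k, l = i + k + 1 := ⟨l - (i + 1), by omega⟩
    have hm : (j : ℕ) + mT (i + 1) = mT (i + k + 1) := by
      rcases hl1.eq_or_lt with h1 | h1
      · rw [← h1] at hl2 ⊢
        omega
      · have := mT_lt_mT (by omega) h1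
        omega
    have hξ : fT^[(j:ℕ)] (xiT (i + 1)) = xiT (i + k + 1) := by rw [hfx, hm, xiT]
    refine tendsto_const_nhds.congr' ?_
    rw [hξ] at hconv
    filter_upwards [haff, eventually_ne_atTop 0,
      hconv.eventually (Metric.ball_mem_nhds _ (hε (i + k + 1) (by omega)))] with n hn hn0 hb
    rw [hξ, add_sub_cancel_left] at hn
    have hw : 3 ^ (j:ℕ) * (radiusT τ n i * u) =
        radiusT τ n (i + k) * (u * 3 ^ (j:ℕ) * Real.sqrt 2 ^ k) := by
      have h2 : (1 / Real.sqrt 2) ^ k * Real.sqrt 2 ^ k = 1 := by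
        rw [← mul_pow, one_div, inv_mul_cancel₀ (by positivity), one_pow]
      rw [radiusT, radiusT, pow_add]
      linear_combination -(3 ^ (j:ℕ) * (τ / (Real.sqrt (24 + 16 * Real.sqrt 2) * n) *
        (1 / Real.sqrt 2) ^ i * u)) * h2
    rw [hw] at hn
    rw [hn] at hb ⊢
    rw [heightT_near_maximal hψ hτ hn0 (by positivity) hb, abs_mul, abs_mul,
      abs_of_pos (by positivity : (0:ℝ) < 3 ^ (j:ℕ)),
      abs_of_pos (by positivity : (0:ℝ) < Real.sqrt 2 ^ k)]
    congr 3
    omega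
  · rw [gK, dif_neg h]
    rw [hfx] at hconv
    refine tendsto_heightT_top hψ hψ₀ hτ (fun l hl heq => h ?_) hconv
    have hm : (j : ℕ) + mT (i + 1) = mT l := fT_iterate_zetaT_injective heq
    refine ⟨l, ?_, by omega⟩
    by_contra! hlt
    have := mT_lt_mT hl hlt
    omega

lemma measurable_fT : Measurable fT :=
  measurable_fract.comp (measurable_const_mul 3)

lemma measurable_gK (t i : ℕ) : Measurable (gK t i) := by
  refine measurable_pi_lambda _ fun j => ?_
  simp only [gK]
  split_ifs
  · fun_prop
  · exact measurable_const

lemma measurable_of_hyperbolic_peaks {ε : ℕ → ℝ} {ψ : ℝ → ℝ}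
    (hψ : ∀ i, 1 ≤ i → ∀ x ∈ Metric.ball (xiT i) (ε i),
      ψ x = ((2 : ℝ) ^ (i - 1))⁻¹ * |x - xiT i| ^ (-2 : ℤ))
    (hψ₀ : ∀ x, (∀ i, 1 ≤ i → x ∉ Metric.ball (xiT i) (ε i)) → ψ x = 0) : Measurable ψ := by
  intro s hs
  have hpre : ψ ⁻¹' s =
      (⋃ i : ℕ, Metric.ball (xiT (i + 1)) (ε (i + 1)) ∩
        (fun x => ((2 : ℝ) ^ i)⁻¹ * |x - xiT (i + 1)| ^ (-2 : ℤ)) ⁻¹' s) ∪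
      ((⋃ i : ℕ, Metric.ball (xiT (i + 1)) (ε (i + 1)))ᶜ ∩ {_x | (0:ℝ) ∈ s}) := by
    ext x
    by_cases hx : ∀ i, 1 ≤ i → x ∉ Metric.ball (xiT i) (ε i)
    · have h' : ∀ i, x ∉ Metric.ball (xiT (i + 1)) (ε (i + 1)) := fun i => hx (i + 1) (by omega)
      simp only [mem_preimage, hψ₀ x hx, mem_union, mem_iUnion, mem_inter_iff, h', false_and,
        exists_false, mem_compl_iff, not_false_eq_true, true_and, false_or, mem_ofPred_eq]
    · push Not at hx
      obtain ⟨i, hi, hxi⟩ := hx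
      obtain ⟨i, rfl⟩ : ∃ k, i = k + 1 := ⟨i - 1, by omega⟩
      have hmem : x ∈ ⋃ i : ℕ, Metric.ball (xiT (i + 1)) (ε (i + 1)) := mem_iUnion.2 ⟨i, hxi⟩
      have hval : ∀ k, x ∈ Metric.ball (xiT (k + 1)) (ε (k + 1)) →
          ψ x = ((2 : ℝ) ^ k)⁻¹ * |x - xiT (k + 1)| ^ (-2 : ℤ) := fun k hk =>
        hψ (k + 1) (by omega) x hk
      simp only [mem_union, mem_inter_iff, mem_compl_iff, hmem, not_true, false_and, or_false]
      rw [mem_iUnion]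
      constructor
      · intro h
        exact ⟨i, hxi, by rwa [mem_preimage, ← hval i hxi]⟩
      · rintro ⟨k, hk, hks⟩
        rwa [mem_preimage, hval k hk]
  rw [hpre]
  have hball : ∀ i : ℕ, MeasurableSet (Metric.ball (xiT (i + 1)) (ε (i + 1))) := fun i =>
    Metric.isOpen_ball.measurableSet
  refine MeasurableSet.union (MeasurableSet.iUnion fun i => (hball i).inter ?_)
    ((MeasurableSet.iUnion hball).compl.inter (MeasurableSet.const _))
  have hmeas : Measurable fun x => ((2 : ℝ) ^ i)⁻¹ * |x - xiT (i + 1)| ^ (-2 : ℤ) := by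
    simp only [zpow_neg]
    norm_cast
    fun_prop
  exact hmeas hs

lemma measurable_heightT_profile {ψ : ℝ → ℝ} (hm : Measurable ψ) (t : ℕ) (τ : ℝ) (n : ℕ) :
    Measurable fun (x : ℝ) (j : Fin (t + 1)) => heightT ψ τ n (fT^[(j : ℕ)] x) := by
  refine measurable_pi_lambda _ fun j => ?_
  have h : Measurable (heightT ψ τ n) := by
    refine Measurable.ite (hm (measurableSet_singleton 0)) measurable_const ?_
    fun_prop
  exact h.comp (measurable_fT.iterate j)

/-- The part of `{ψ > τ⁻² a_n}` around the `i`-th maximal point, counted from `0`. -/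
def peakT (ε : ℕ → ℝ) (τ : ℝ) (n i : ℕ) : Set ℝ :=
  {x ∈ Metric.ball (xiT (i + 1)) (ε (i + 1)) |
    x ≠ xiT (i + 1) ∧ |x - xiT (i + 1)| < radiusT τ n i}

lemma measurableSet_peakT (ε : ℕ → ℝ) (τ : ℝ) (n i : ℕ) : MeasurableSet (peakT ε τ n i) := by
  refine Metric.isOpen_ball.measurableSet.inter
    ((measurableSet_singleton (xiT (i + 1))).compl.inter ?_)
  have hmeas : Measurable fun x => |x - xiT (i + 1)| := by fun_prop
  exact measurableSet_lt hmeas measurable_const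

lemma superlevel_eq_iUnion_peakT {ε : ℕ → ℝ}
    (hsub : ∀ i, 1 ≤ i → Metric.ball (xiT i) (ε i) ⊆ Ioo (0:ℝ) 1) {ψ : ℝ → ℝ}
    (hψ : ∀ i, 1 ≤ i → ∀ x ∈ Metric.ball (xiT i) (ε i),
      ψ x = ((2 : ℝ) ^ (i - 1))⁻¹ * |x - xiT i| ^ (-2 : ℤ))
    (hψ₀ : ∀ x, (∀ i, 1 ≤ i → x ∉ Metric.ball (xiT i) (ε i)) → ψ x = 0)
    {τ : ℝ} (hτ : 0 < τ) {n : ℕ} (hn : n ≠ 0) :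
    {x ∈ Icc (0:ℝ) 1 | ψ x > τ ^ (-2 : ℤ) * ((24 + 16 * Real.sqrt 2) * (n : ℝ) ^ 2)} =
      ⋃ i, peakT ε τ n i := by
  have hn' : (0:ℝ) < n := by positivity
  have hkey : ∀ i : ℕ, ∀ x ∈ Metric.ball (xiT (i + 1)) (ε (i + 1)),
      (ψ x > τ ^ (-2 : ℤ) * ((24 + 16 * Real.sqrt 2) * (n : ℝ) ^ 2) ↔ x ∈ peakT ε τ n i) := by
    intro i x hx
    have hv := hψ (i + 1) (by omega) x hx
    have hr := radiusT_pos hτ hn i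
    have hsq := radiusT_sq τ n i
    rw [if_neg hn] at hsq
    have hlev : τ ^ (-2 : ℤ) * ((24 + 16 * Real.sqrt 2) * (n : ℝ) ^ 2) =
        ((2:ℝ) ^ i)⁻¹ * (radiusT τ n i ^ 2)⁻¹ := by
      rw [zpow_neg, zpow_ofNat, ← hsq]
      field_simp
    rw [hv, hlev, add_tsub_cancel_right, gt_iff_lt, mul_lt_mul_iff_right₀ (by positivity), zpow_neg]
    norm_cast
    by_cases hx0 : x = xiT (i + 1)
    · subst hx0
      simp [peakT, sq_nonneg]
    · have h0 : 0 < |x - xiT (i + 1)| := abs_pos.2 (sub_ne_zero.2 hx0)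
      rw [inv_lt_inv₀ (by positivity) (by positivity), sq_lt_sq₀ h0.le hr.le]
      exact ⟨fun h => ⟨hx, hx0, h⟩, fun h => h.2.2⟩
  ext x
  rw [mem_iUnion]
  constructor
  · rintro ⟨-, hx⟩
    obtain ⟨i, hi, hb⟩ : ∃ l, 1 ≤ l ∧ x ∈ Metric.ball (xiT l) (ε l) := by
      by_contra! hcon
      rw [hψ₀ x hcon] at hx
      exact absurd hx (not_lt.2 (by positivity))
    obtain ⟨i, rfl⟩ : ∃ k, i = k + 1 := ⟨i - 1, by omega⟩
    exact ⟨i, (hkey i x hb).1 hx⟩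
  · rintro ⟨i, hi⟩
    exact ⟨Ioo_subset_Icc_self (hsub (i + 1) (by omega) hi.1), (hkey i x hi.1).2 hi⟩

lemma setIntegral_peakT (ε : ℕ → ℝ) {τ : ℝ} (hτ : 0 < τ) {n : ℕ} (hn : n ≠ 0) (i : ℕ)
    (G : ℝ → ℝ) :
    ∫ x in peakT ε τ n i, G x = radiusT τ n i *
      ∫ u, (peakT ε τ n i).indicator G (xiT (i + 1) + radiusT τ n i * u) := by
  have hr := radiusT_pos hτ hn i
  rw [← integral_indicator (measurableSet_peakT ε τ n i),
    ← integral_add_left_eq_self _ (xiT (i + 1)),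
    Measure.integral_comp_mul_left (fun y => (peakT ε τ n i).indicator G (xiT (i + 1) + y)),
    abs_of_pos (inv_pos.2 hr), smul_eq_mul, mul_inv_cancel_left₀ hr.ne']

lemma add_radiusT_mul_mem_peakT_iff (ε : ℕ → ℝ) {τ : ℝ} (hτ : 0 < τ) {n : ℕ} (hn : n ≠ 0) (i : ℕ)
    (u : ℝ) : xiT (i + 1) + radiusT τ n i * u ∈ peakT ε τ n i ↔
      xiT (i + 1) + radiusT τ n i * u ∈ Metric.ball (xiT (i + 1)) (ε (i + 1)) ∧ u ≠ 0 ∧ |u| < 1 := by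
  have hr := radiusT_pos hτ hn i
  rw [peakT, mem_ofPred_eq, add_sub_cancel_left, abs_mul, abs_of_pos hr,
    mul_lt_iff_lt_one_right hr, Ne, add_eq_left, mul_eq_zero, not_or]
  simp [hr.ne']

lemma norm_indicator_peakT_le (ε : ℕ → ℝ) {τ : ℝ} (hτ : 0 < τ) {n : ℕ} (hn : n ≠ 0) (i : ℕ)
    {G : ℝ → ℝ} {C : ℝ} (hG : ∀ x, ‖G x‖ ≤ C) (u : ℝ) :
    ‖(peakT ε τ n i).indicator G (xiT (i + 1) + radiusT τ n i * u)‖ ≤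
      (Icc (-1:ℝ) 1).indicator (fun _ => C) u := by
  have hC : 0 ≤ C := (norm_nonneg _).trans (hG 0)
  by_cases hu : xiT (i + 1) + radiusT τ n i * u ∈ peakT ε τ n i
  · have h1 := abs_lt.1 ((add_radiusT_mul_mem_peakT_iff ε hτ hn i u).1 hu).2.2
    rw [indicator_of_mem hu, indicator_of_mem (show u ∈ Icc (-1:ℝ) 1 from ⟨h1.1.le, h1.2.le⟩)]
    exact hG _
  · rw [indicator_of_notMem hu, norm_zero]
    exact indicator_nonneg (fun _ _ => hC) u

lemma integrable_indicator_Icc_const (C : ℝ) :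
    Integrable ((Icc (-1:ℝ) 1).indicator fun _ => C) :=
  (integrable_indicator_iff measurableSet_Icc).2 (integrableOn_const (by simp))

lemma integral_indicator_Icc_const (C : ℝ) :
    ∫ u, (Icc (-1:ℝ) 1).indicator (fun _ => C) u = 2 * C := by
  rw [integral_indicator measurableSet_Icc, setIntegral_const]
  norm_num [Measure.real]

lemma integral_indicator_Iio_abs (L : ℝ → ℝ) :
    ∫ u, (Iio (1:ℝ)).indicator L |u| = 2 * ∫ u, L u ∂unif01 := by
  rw [integral_comp_abs (f := (Iio (1:ℝ)).indicator L), setIntegral_indicator measurableSet_Iio,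
    Ioi_inter_Iio, unif01, integral_Icc_eq_integral_Ioo]

lemma tendsto_integral_peakT {ε : ℕ → ℝ} (hε : ∀ i, 1 ≤ i → 0 < ε i) {τ : ℝ} (hτ : 0 < τ)
    {G : ℕ → ℝ → ℝ} (hGm : ∀ n, Measurable (G n)) {C : ℝ} (hG : ∀ n x, ‖G n x‖ ≤ C) (i : ℕ)
    {L : ℝ → ℝ} (hL : ∀ u ≠ 0,
      Tendsto (fun n => G n (xiT (i + 1) + radiusT τ n i * u)) atTop (nhds (L |u|))) :
    Tendsto (fun n => ∫ u, (peakT ε τ n i).indicator (G n) (xiT (i + 1) + radiusT τ n i * u))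
      atTop (nhds (2 * ∫ u, L u ∂unif01)) := by
  rw [← integral_indicator_Iio_abs]
  refine tendsto_integral_filter_of_dominated_convergence _ ?_ ?_
    (integrable_indicator_Icc_const C) ?_
  · refine Eventually.of_forall fun n => Measurable.aestronglyMeasurable ?_
    exact ((hGm n).indicator (measurableSet_peakT ε τ n i)).comp (by fun_prop)
  · filter_upwards [eventually_ne_atTop 0] with n hn
    exact Eventually.of_forall (norm_indicator_peakT_le ε hτ hn i (hG n))
  · filter_upwards [compl_mem_ae_iff.2 (measure_singleton (0:ℝ))] with u hu
    have hu0 : u ≠ 0 := hu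
    have hx : Tendsto (fun n => xiT (i + 1) + radiusT τ n i * u) atTop (nhds (xiT (i + 1))) := by
      simpa using ((tendsto_radiusT τ i).mul_const u).const_add (xiT (i + 1))
    have hball := hx.eventually (Metric.ball_mem_nhds _ (hε (i + 1) (by omega)))
    by_cases hu1 : |u| < 1
    · rw [indicator_of_mem (show |u| ∈ Iio (1:ℝ) from hu1)]
      refine (hL u hu0).congr' ?_
      filter_upwards [hball, eventually_ne_atTop 0] with n hb hn
      rw [indicator_of_mem ((add_radiusT_mul_mem_peakT_iff ε hτ hn i u).2 ⟨hb, hu0, hu1⟩)]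
    · rw [indicator_of_notMem (show |u| ∉ Iio (1:ℝ) from hu1)]
      refine tendsto_const_nhds.congr' ?_
      filter_upwards [eventually_ne_atTop 0] with n hn
      rw [indicator_of_notMem fun h => hu1 ((add_radiusT_mul_mem_peakT_iff ε hτ hn i u).1 h).2.2]

lemma one_div_sqrt_two_lt_one : 1 / Real.sqrt 2 < 1 := by
  rw [div_lt_one (by positivity), Real.lt_sqrt (by norm_num)]
  norm_num

/-- Rescaled integrals over the union of the peaks converge to the geometric mixture of the
integrals of the profiles. -/
lemma tendsto_setIntegral_iUnion_peakT {ε : ℕ → ℝ} (hε : ∀ i, 1 ≤ i → 0 < ε i)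
    (hdisj : ∀ i j, 1 ≤ i → 1 ≤ j → i ≠ j →
      Disjoint (Metric.ball (xiT i) (ε i)) (Metric.ball (xiT j) (ε j)))
    (hsub : ∀ i, 1 ≤ i → Metric.ball (xiT i) (ε i) ⊆ Ioo (0:ℝ) 1)
    {τ : ℝ} (hτ : 0 < τ) {G : ℕ → ℝ → ℝ} (hGm : ∀ n, Measurable (G n)) {C : ℝ}
    (hG : ∀ n x, ‖G n x‖ ≤ C) {L : ℕ → ℝ → ℝ} (hL : ∀ i, ∀ u ≠ 0,
      Tendsto (fun n => G n (xiT (i + 1) + radiusT τ n i * u)) atTop (nhds (L i |u|))) :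
    Tendsto (fun n => (radiusT τ n 0)⁻¹ * ∫ x in ⋃ i, peakT ε τ n i, G n x) atTop
      (nhds (∑' i : ℕ, (1 / Real.sqrt 2) ^ i * (2 * ∫ u, L i u ∂unif01))) := by
  have hgeo : Summable fun i : ℕ => (1 / Real.sqrt 2) ^ i * (2 * C) :=
    (summable_geometric_of_lt_one (by positivity) one_div_sqrt_two_lt_one).mul_right _
  have hlim := tendsto_tsum_of_dominated_convergence (𝓕 := atTop)
    (f := fun (n : ℕ) i => (1 / Real.sqrt 2) ^ i *
      ∫ u, (peakT ε τ n i).indicator (G n) (xiT (i + 1) + radiusT τ n i * u)) hgeo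
    (fun i => (tendsto_integral_peakT hε hτ hGm hG i (hL i)).const_mul _) ?_
  · refine hlim.congr' ?_
    filter_upwards [eventually_ne_atTop 0] with n hn
    have hint : IntegrableOn (G n) (⋃ i, peakT ε τ n i) := by
      have hfin : volume (⋃ i, peakT ε τ n i) ≠ ⊤ := by
        have hss : ⋃ i, peakT ε τ n i ⊆ Ioo (0:ℝ) 1 :=
          iUnion_subset fun i x hx => hsub (i + 1) (by omega) hx.1
        exact ((measure_mono hss).trans_lt measure_Ioo_lt_top).ne
      have : IsFiniteMeasure (volume.restrict (⋃ i, peakT ε τ n i)) :=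
        isFiniteMeasure_restrict.2 hfin
      exact Integrable.of_bound (hGm n).aestronglyMeasurable C (Eventually.of_forall (hG n))
    have hdisj' : Pairwise (Function.onFun Disjoint fun i => peakT ε τ n i) := fun i k hik =>
      (hdisj (i + 1) (k + 1) (by omega) (by omega) (by omega)).mono
        (fun _ hx => hx.1) (fun _ hx => hx.1)
    rw [integral_iUnion (measurableSet_peakT ε τ n) hdisj' hint, ← tsum_mul_left]
    refine tsum_congr fun i => ?_
    rw [setIntegral_peakT ε hτ hn, ← mul_assoc]
    congr 1
    have h0 := (radiusT_pos hτ hn 0).ne'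
    have : radiusT τ n i = radiusT τ n 0 * (1 / Real.sqrt 2) ^ i := by simp [radiusT]
    rw [this, inv_mul_cancel_left₀ h0]
  · filter_upwards [eventually_ne_atTop 0] with n hn i
    rw [norm_mul, Real.norm_of_nonneg (by positivity), ← integral_indicator_Icc_const]
    refine mul_le_mul_of_nonneg_left ?_ (by positivity)
    exact norm_integral_le_of_norm_le (integrable_indicator_Icc_const C)
      (Eventually.of_forall (norm_indicator_peakT_le ε hτ hn i (hG n)))

instance : IsProbabilityMeasure unif01 := ⟨by simp [unif01]⟩

lemma tsum_ofReal_geometric_weights : ∑' i : ℕ,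
    ENNReal.ofReal ((1 - 1 / Real.sqrt 2) * (1 / Real.sqrt 2) ^ i) = 1 := by
  have h1 : 0 ≤ 1 - 1 / Real.sqrt 2 := sub_nonneg.2 one_div_sqrt_two_lt_one.le
  rw [← ENNReal.ofReal_tsum_of_nonneg (fun i => by positivity)
    ((summable_geometric_of_lt_one (by positivity) one_div_sqrt_two_lt_one).mul_left _),
    tsum_mul_left, tsum_geometric_of_lt_one (by positivity) one_div_sqrt_two_lt_one,
    mul_inv_cancel₀ (sub_pos.2 one_div_sqrt_two_lt_one).ne', ENNReal.ofReal_one]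

instance (t : ℕ) : IsProbabilityMeasure (limitLaw17 t) := by
  refine ⟨?_⟩
  have h : ∀ i, (unif01.map (gK t i)) univ = 1 := fun i => by
    rw [Measure.map_apply (measurable_gK t i) MeasurableSet.univ, preimage_univ, measure_univ]
  simp [limitLaw17, Measure.sum_apply _ MeasurableSet.univ, h, -one_div,
    tsum_ofReal_geometric_weights]

lemma integral_limitLaw17 (t : ℕ) (g : BoundedContinuousFunction (Fin (t + 1) → ℝ≥0∞) ℝ) :
    ∫ v, g v ∂(limitLaw17 t) = ∑' i : ℕ, (1 - 1 / Real.sqrt 2) * (1 / Real.sqrt 2) ^ i *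
      ∫ u, g (gK t (i + 1) u) ∂unif01 := by
  have hgm : Measurable g := g.continuous.measurable
  have hint : Integrable g (limitLaw17 t) :=
    Integrable.of_bound hgm.aestronglyMeasurable ‖g‖ (Eventually.of_forall g.norm_coe_le_norm)
  rw [limitLaw17] at hint ⊢
  rw [integral_sum_measure hint]
  refine tsum_congr fun i => ?_
  have h1 : 0 ≤ 1 - 1 / Real.sqrt 2 := sub_nonneg.2 one_div_sqrt_two_lt_one.le
  rw [integral_smul_measure, ENNReal.toReal_ofReal (by positivity), smul_eq_mul,
    integral_map (measurable_gK t (i + 1)).aemeasurable hgm.aestronglyMeasurable]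

/-- the law of `Vₙ(x) = (τ^{−1}(ψ(f^j x)/(24+16√2)n²)^{−1/2})_{0 ≤ j ≤ t}`
(with value `∞` where `ψ(f^j x) = 0`) under `Leb` conditioned on
`{ψ > τ^{−2}·(24+16√2)n²}` converges weakly to the law of `(Y_j)_{0 ≤ j ≤ t}`, i.e. the
corresponding integrals of every bounded continuous function converge. -/
theorem stmt17
    (ε : ℕ → ℝ) (hε : ∀ i, 1 ≤ i → 0 < ε i)
    (hdisj : ∀ i j, 1 ≤ i → 1 ≤ j → i ≠ j →
      Disjoint (Metric.ball (xiT i) (ε i)) (Metric.ball (xiT j) (ε j)))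
    (hsub : ∀ i, 1 ≤ i → Metric.ball (xiT i) (ε i) ⊆ Ioo (0:ℝ) 1)
    (ψ : ℝ → ℝ)
    (hψ : ∀ i, 1 ≤ i → ∀ x ∈ Metric.ball (xiT i) (ε i),
      ψ x = ((2 : ℝ) ^ (i - 1))⁻¹ * |x - xiT i| ^ (-2 : ℤ))
    (hψ₀ : ∀ x, (∀ i, 1 ≤ i → x ∉ Metric.ball (xiT i) (ε i)) → ψ x = 0)
    (t : ℕ) (τ : ℝ) (hτ : 0 < τ)
    (V : ℕ → ℝ → (Fin (t + 1) → ℝ≥0∞))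
    (hV : ∀ (n : ℕ) (x : ℝ) (j : Fin (t + 1)),
      V n x j =
        if ψ (fT^[(j : ℕ)] x) = 0 then ⊤
        else ENNReal.ofReal
          (τ⁻¹ * (ψ (fT^[(j : ℕ)] x) / ((24 + 16 * Real.sqrt 2) * (n : ℝ) ^ 2)) ^
            (-(1/2) : ℝ)))
    (E : ℕ → Set ℝ)
    (hE : ∀ n : ℕ, E n =
      {x ∈ Icc (0:ℝ) 1 | ψ x > τ ^ (-2 : ℤ) * ((24 + 16 * Real.sqrt 2) * (n : ℝ) ^ 2)}) :
    ∀ g : BoundedContinuousFunction (Fin (t + 1) → ℝ≥0∞) ℝ,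
      Tendsto
        (fun n : ℕ => ∫ x, g (V n x) ∂(ProbabilityTheory.cond volume (E n)))
        atTop (nhds (∫ v, g v ∂(limitLaw17 t))) := by
  intro g
  have hm : Measurable ψ := measurable_of_hyperbolic_peaks hψ hψ₀
  have hVeq : V = fun n x (j : Fin (t + 1)) => heightT ψ τ n (fT^[(j : ℕ)] x) := by
    funext n x j
    rw [hV, heightT]
  have hVm : ∀ n, Measurable (V n) := fun n => by
    rw [hVeq]
    exact measurable_heightT_profile hm t τ n
  have hnum := tendsto_setIntegral_iUnion_peakT hε hdisj hsub hτ
    (G := fun n x => g (V n x)) (fun n => g.continuous.measurable.comp (hVm n))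
    (fun n x => g.norm_coe_le_norm (V n x)) (L := fun i u => g (gK t (i + 1) u))
    (fun i u hu => (g.continuous.tendsto _).comp (by
      rw [hVeq]
      exact tendsto_heightT_profile hε hψ hψ₀ t hτ i hu))
  have hden := tendsto_setIntegral_iUnion_peakT hε hdisj hsub hτ
    (G := fun _ _ => (1:ℝ)) (fun _ => measurable_const) (C := 1) (fun _ _ => by simp)
    (L := fun _ _ => 1) (fun _ _ _ => tendsto_const_nhds)
  have h1 : 0 < 1 - 1 / Real.sqrt 2 := sub_pos.2 one_div_sqrt_two_lt_one
  have hden1 : ∑' i : ℕ, (1 / Real.sqrt 2) ^ i * (2 * ∫ _, (1:ℝ) ∂unif01) =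
      2 * (1 - 1 / Real.sqrt 2)⁻¹ := by
    rw [tsum_mul_right, tsum_geometric_of_lt_one (by positivity) one_div_sqrt_two_lt_one]
    simp [mul_comm]
  rw [hden1] at hden
  have hlim := hnum.div hden (by positivity)
  have hval : ∫ v, g v ∂(limitLaw17 t) =
      (∑' i : ℕ, (1 / Real.sqrt 2) ^ i * (2 * ∫ u, g (gK t (i + 1) u) ∂unif01)) /
        (2 * (1 - 1 / Real.sqrt 2)⁻¹) := by
    rw [integral_limitLaw17, ← tsum_div_const]
    refine tsum_congr fun i => ?_
    field_simp
  rw [hval]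
  refine hlim.congr' ?_
  filter_upwards [eventually_ne_atTop 0] with n hn
  have hr := (radiusT_pos hτ hn 0).ne'
  rw [Pi.div_apply, hE, superlevel_eq_iUnion_peakT hsub hψ hψ₀ hτ hn, ProbabilityTheory.cond,
    integral_smul_measure, ENNReal.toReal_inv, smul_eq_mul,
    mul_div_mul_left _ _ (inv_ne_zero hr), setIntegral_const, smul_eq_mul, mul_one, Measure.real,
    inv_mul_eq_div]
end
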